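/- Let P_1, …, P_m be a Clifford system of signature (m, r) on ℝ^{2l}_s with m ≡ 0 (mod 4), r ≡ 0 (mod 2), s ≤ 2l − 1, and l > m. Define f : S^{2l−1}_s → ℝ by f(x) := 1 − 2 Σ_{j=1}^{m} η_{jj} ⟨P_jx, x⟩², and for c ∈ ℝ set M_c := f^{−1}(c). Suppose c lies in W_RN(f) ∩ (−1, ∞), which equals (−1, 1) if r = 0, equals (−1, ∞) \ {1} if 0 < r < m, and equals (1, ∞) if r = m. Then each connected component of M_c is inhomogeneous: there is no subgroup K of the pseudo-orthogonal group O(s, 2l−s) which leaves that component invariant and acts transitively on it. -/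

import Mathlib

open Matrix

noncomputable section

/-- Entries of the signature matrix `J_{r,m-r}`, with 1-based indices:
`η_{ii} = -1` for `1 ≤ i ≤ r` and `η_{ii} = 1` for `r < i`; off-diagonal entries vanish. -/
def cliffEta (r i j : ℕ) : ℝ :=
  if i = j then (if i ≤ r then -1 else 1) else 0

/-- The matrix `J_{s,n-s} = diag(-E_s, E_{n-s})`. -/
def psJ (n s : ℕ) : Matrix (Fin n) (Fin n) ℝ :=
  Matrix.diagonal fun i => if (i : ℕ) < s then (-1 : ℝ) else 1

/-- The pseudo-inner product `⟨u, v⟩ = uᵀ J_{s,n-s} v` of `ℝ^n_s`. -/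
def psInner (n s : ℕ) (u v : Fin n → ℝ) : ℝ :=
  u ⬝ᵥ ((psJ n s) *ᵥ v)

/-- A Clifford system of signature `(m, r)` on `ℝ^{2l}_s`, indexed by `1, …, m`:
each `P i` is symmetric with respect to the pseudo-inner product, and
`P i * P j + P j * P i = 2 η_{ij} E_{2l}`. -/
def IsCliffordSystem (l s m r : ℕ)
    (P : ℕ → Matrix (Fin (2 * l)) (Fin (2 * l)) ℝ) : Prop :=
  (∀ i ∈ Finset.Icc 1 m, (P i)ᵀ = psJ (2 * l) s * P i * psJ (2 * l) s) ∧
  (∀ i ∈ Finset.Icc 1 m, ∀ j ∈ Finset.Icc 1 m,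
    P i * P j + P j * P i
      = (2 * cliffEta r i j) • (1 : Matrix (Fin (2 * l)) (Fin (2 * l)) ℝ))

/-- A subset `L ⊆ ℝ^n_s` is homogeneous if some subgroup `K` of the pseudo-orthogonal
group `O(s, n-s)` leaves `L` invariant and acts transitively on `L`. -/
def IsHomogeneousIn (n s : ℕ) (L : Set (Fin n → ℝ)) : Prop :=
  ∃ K : Set (Matrix (Fin n) (Fin n) ℝ),
    (∀ A ∈ K, Aᵀ * psJ n s * A = psJ n s) ∧
    (1 : Matrix (Fin n) (Fin n) ℝ) ∈ K ∧
    (∀ A ∈ K, ∀ B ∈ K, A * B ∈ K) ∧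
    (∀ A ∈ K, ∃ B ∈ K, A * B = 1 ∧ B * A = 1) ∧
    (∀ A ∈ K, ∀ x ∈ L, A *ᵥ x ∈ L) ∧
    (∀ x ∈ L, ∀ y ∈ L, ∃ A ∈ K, A *ᵥ x = y)

/-- bilinear form of a matrix -/
def bf {n : ℕ} (J : Matrix (Fin n) (Fin n) ℝ) (x y : Fin n → ℝ) : ℝ := x ⬝ᵥ (J *ᵥ y)

/-- Clifford data, zero-based -/
structure CliffData (n : ℕ) (J : Matrix (Fin n) (Fin n) ℝ) (m : ℕ) (η : ℕ → ℝ)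
    (P : ℕ → Matrix (Fin n) (Fin n) ℝ) : Prop where
  Jt : Jᵀ = J
  JJ : J * J = 1
  ηsq : ∀ i, η i * η i = 1
  sym : ∀ i < m, (P i)ᵀ = J * P i * J
  sq : ∀ i < m, P i * P i = η i • (1 : Matrix (Fin n) (Fin n) ℝ)
  anti : ∀ i < m, ∀ j < m, i ≠ j → P i * P j = -(P j * P i)

/-- the quartic form -/
def pq {n : ℕ} (J : Matrix (Fin n) (Fin n) ℝ) (m : ℕ) (η : ℕ → ℝ)
    (P : ℕ → Matrix (Fin n) (Fin n) ℝ) (x : Fin n → ℝ) : ℝ :=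
  ∑ j ∈ Finset.range m, η j * (bf J (P j *ᵥ x) x) ^ 2

/-- the Clifford matrix of a point -/
def nm {n : ℕ} (J : Matrix (Fin n) (Fin n) ℝ) (m : ℕ) (η : ℕ → ℝ)
    (P : ℕ → Matrix (Fin n) (Fin n) ℝ) (x : Fin n → ℝ) : Matrix (Fin n) (Fin n) ℝ :=
  ∑ j ∈ Finset.range m, (η j * bf J (P j *ᵥ x) x) • P j

section basics
variable {n : ℕ} {J : Matrix (Fin n) (Fin n) ℝ} {m : ℕ} {η : ℕ → ℝ}
  {P : ℕ → Matrix (Fin n) (Fin n) ℝ}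

lemma bf_add_left (x y z : Fin n → ℝ) : bf J (x + y) z = bf J x z + bf J y z := by
  simp [bf, add_dotProduct]
lemma bf_add_right (x y z : Fin n → ℝ) : bf J x (y + z) = bf J x y + bf J x z := by
  simp [bf, mulVec_add, dotProduct_add]
lemma bf_smul_left (a : ℝ) (x y : Fin n → ℝ) : bf J (a • x) y = a * bf J x y := by
  simp [bf]
lemma bf_smul_right (a : ℝ) (x y : Fin n → ℝ) : bf J x (a • y) = a * bf J x y := by
  simp [bf, mulVec_smul]
lemma bf_neg_left (x y : Fin n → ℝ) : bf J (-x) y = - bf J x y := by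
  simp [bf]
lemma bf_neg_right (x y : Fin n → ℝ) : bf J x (-y) = - bf J x y := by
  simp [bf, mulVec_neg]
lemma bf_sub_left (x y z : Fin n → ℝ) : bf J (x - y) z = bf J x z - bf J y z := by
  simp [bf, sub_dotProduct]
lemma bf_sub_right (x y z : Fin n → ℝ) : bf J x (y - z) = bf J x y - bf J x z := by
  simp [bf, mulVec_sub, dotProduct_sub]
lemma bf_sum_left {ι : Type*} (s : Finset ι) (f : ι → Fin n → ℝ) (z : Fin n → ℝ) :
    bf J (∑ i ∈ s, f i) z = ∑ i ∈ s, bf J (f i) z := by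
  simp [bf, sum_dotProduct]

lemma bf_comm (hJ : Jᵀ = J) (x y : Fin n → ℝ) : bf J x y = bf J y x := by
  unfold bf
  rw [dotProduct_comm, ← vecMul_transpose, hJ, dotProduct_mulVec]

lemma bf_adj (hJ : J * J = 1) {M M' : Matrix (Fin n) (Fin n) ℝ} (hM : Mᵀ = J * M' * J)
    (x y : Fin n → ℝ) : bf J (M *ᵥ x) y = bf J x (M' *ᵥ y) := by
  unfold bf
  rw [dotProduct_comm, dotProduct_mulVec, ← mulVec_transpose, hM, dotProduct_comm, mulVec_mulVec,
    mulVec_mulVec]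
  rw [Matrix.mul_assoc, hJ, Matrix.mul_one]

lemma bf_nondeg (hJ : J * J = 1) {x : Fin n → ℝ} (h : ∀ y, bf J x y = 0) : x = 0 := by
  have : ∀ y, x ⬝ᵥ y = 0 := fun y => by
    have := h (J *ᵥ y)
    unfold bf at this
    rwa [mulVec_mulVec, hJ, one_mulVec] at this
  exact dotProduct_eq_zero x this

lemma pq_smul (a : ℝ) (x : Fin n → ℝ) : pq J m η P (a • x) = a ^ 4 * pq J m η P x := by
  unfold pq
  rw [Finset.mul_sum]
  refine Finset.sum_congr rfl fun j _ => ?_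
  rw [mulVec_smul, bf_smul_left, bf_smul_right]; ring

lemma nm_sym (h : CliffData n J m η P) (x) : (nm J m η P x)ᵀ = J * nm J m η P x * J := by
  unfold nm
  rw [transpose_sum, Finset.mul_sum, Finset.sum_mul]
  refine Finset.sum_congr rfl fun j hj => ?_
  rw [transpose_smul, h.sym j (Finset.mem_range.1 hj)]
  simp

lemma cl_nm (h : CliffData n J m η P) (x) {i : ℕ} (hi : i < m) :
    P i * nm J m η P x + nm J m η P x * P i =
      (2 * bf J (P i *ᵥ x) x) • (1 : Matrix (Fin n) (Fin n) ℝ) := by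
  unfold nm
  rw [Finset.mul_sum, Finset.sum_mul, ← Finset.sum_add_distrib]
  rw [Finset.sum_eq_single_of_mem i (Finset.mem_range.2 hi)]
  · rw [Matrix.mul_smul, Matrix.smul_mul, h.sq i hi, smul_smul, ← add_smul]
    congr 1
    linear_combination (2 * bf J (P i *ᵥ x) x) * h.ηsq i
  · intro j hj hne
    rw [Matrix.mul_smul, Matrix.smul_mul, h.anti i hi j (Finset.mem_range.1 hj) (Ne.symm hne)]
    simp

lemma nm_sq (h : CliffData n J m η P) (x) :
    nm J m η P x * nm J m η P x = (pq J m η P x) • (1 : Matrix (Fin n) (Fin n) ℝ) := by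
  have h1 : (2:ℝ) • (nm J m η P x * nm J m η P x) =
      (2:ℝ) • ((pq J m η P x) • (1 : Matrix (Fin n) (Fin n) ℝ)) := by
    rw [two_smul]
    conv_lhs =>
      congr
      · enter [1]; unfold nm
      · enter [2]; unfold nm
    rw [Finset.mul_sum, Finset.sum_mul, ← Finset.sum_add_distrib, pq, Finset.sum_smul,
      Finset.smul_sum]
    refine Finset.sum_congr rfl fun j hj => ?_
    have := cl_nm h x (Finset.mem_range.1 hj)
    rw [Matrix.mul_smul, Matrix.smul_mul, ← smul_add, this, smul_smul, smul_smul]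
    congr 1; ring
  exact smul_right_injective _ (two_ne_zero) h1

lemma bf_nm_self (x : Fin n → ℝ) : bf J (nm J m η P x *ᵥ x) x = pq J m η P x := by
  unfold nm pq
  rw [sum_mulVec, bf_sum_left]
  refine Finset.sum_congr rfl fun j _ => ?_
  rw [smul_mulVec, bf_smul_left]; ring

/-- generic quadratic expansions in the plane spanned by `y` and `N y`. -/
lemma bf_plane (M : Matrix (Fin n) (Fin n) ℝ) (y w : Fin n → ℝ) (a b : ℝ) :
    bf J (M *ᵥ (a • y + b • w)) (a • y + b • w) =
    a ^ 2 * bf J (M *ᵥ y) y + a * b * (bf J (M *ᵥ y) w + bf J (M *ᵥ w) y)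
      + b ^ 2 * bf J (M *ᵥ w) w := by
  simp only [mulVec_add, mulVec_smul, bf_add_left, bf_add_right, bf_smul_left, bf_smul_right]
  ring

lemma pj_plane (h : CliffData n J m η P) (y : Fin n → ℝ) (a b : ℝ) {j : ℕ} (hj : j < m) :
    bf J (P j *ᵥ (a • y + b • (nm J m η P y *ᵥ y))) (a • y + b • (nm J m η P y *ᵥ y)) =
    (a ^ 2 + 2 * a * b * bf J y y + pq J m η P y * b ^ 2) * bf J (P j *ᵥ y) y := by
  rw [bf_plane]
  set N := nm J m η P y with hN
  have e1 : bf J (P j *ᵥ y) (N *ᵥ y) + bf J (P j *ᵥ (N *ᵥ y)) y =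
      2 * bf J (P j *ᵥ y) y * bf J y y := by
    rw [← bf_adj h.JJ (nm_sym h y), ← bf_add_left, mulVec_mulVec, mulVec_mulVec, ← add_mulVec,
      add_comm, cl_nm h y hj, smul_mulVec, one_mulVec, bf_smul_left]
  have e2 : bf J (P j *ᵥ (N *ᵥ y)) (N *ᵥ y) = pq J m η P y * bf J (P j *ᵥ y) y := by
    rw [← bf_adj h.JJ (nm_sym h y), mulVec_mulVec, mulVec_mulVec]
    have : N * P j * N = (2 * bf J (P j *ᵥ y) y) • N - (pq J m η P y) • P j := by
      have e := cl_nm h y hj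
      have : N * P j = (2 * bf J (P j *ᵥ y) y) • 1 - P j * N := by
        rw [← e]; abel
      rw [this, Matrix.sub_mul, Matrix.mul_assoc, nm_sq h]
      simp
    rw [← hN, this, sub_mulVec, smul_mulVec, smul_mulVec, bf_sub_left, bf_smul_left, bf_smul_left,
      bf_nm_self]
    ring
  rw [e1, e2]; ring

lemma nm_plane (h : CliffData n J m η P) (y : Fin n → ℝ) (a b : ℝ) :
    nm J m η P (a • y + b • (nm J m η P y *ᵥ y)) =
    (a ^ 2 + 2 * a * b * bf J y y + pq J m η P y * b ^ 2) • nm J m η P y := by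
  conv_lhs => unfold nm
  conv_rhs => rw [nm, Finset.smul_sum]
  refine Finset.sum_congr rfl fun j hj => ?_
  have := pj_plane h y a b (Finset.mem_range.1 hj)
  conv_lhs at this => unfold nm
  rw [this, smul_smul]; congr 1; ring

lemma pq_plane (h : CliffData n J m η P) (y : Fin n → ℝ) (a b : ℝ) :
    pq J m η P (a • y + b • (nm J m η P y *ᵥ y)) =
    (a ^ 2 + 2 * a * b * bf J y y + pq J m η P y * b ^ 2) ^ 2 * pq J m η P y := by
  conv_lhs => unfold pq
  conv_rhs => enter [2]; rw [pq]
  rw [Finset.mul_sum]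
  refine Finset.sum_congr rfl fun j hj => ?_
  rw [pj_plane h y a b (Finset.mem_range.1 hj)]; ring

lemma bf_nm_nm (h : CliffData n J m η P) (y : Fin n → ℝ) :
    bf J (nm J m η P y *ᵥ y) (nm J m η P y *ᵥ y) = pq J m η P y * bf J y y := by
  rw [← bf_adj h.JJ (nm_sym h y), mulVec_mulVec, nm_sq h, smul_mulVec, one_mulVec, bf_smul_left]

lemma qq_plane (h : CliffData n J m η P) (y : Fin n → ℝ) (a b : ℝ) :
    bf J (a • y + b • (nm J m η P y *ᵥ y)) (a • y + b • (nm J m η P y *ᵥ y)) =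
    a ^ 2 * bf J y y + 2 * a * b * pq J m η P y + b ^ 2 * pq J m η P y * bf J y y := by
  have := bf_plane (J := J) 1 y (nm J m η P y *ᵥ y) a b
  simp only [one_mulVec] at this
  rw [this, bf_nm_nm h, bf_comm h.Jt y (nm J m η P y *ᵥ y), bf_nm_self]; ring

lemma hq_plane (h : CliffData n J m η P) {Q : Matrix (Fin n) (Fin n) ℝ}
    (hQP : ∀ j < m, P j * Q = - (Q * P j)) (y : Fin n → ℝ) (a b : ℝ) :
    bf J (Q *ᵥ (a • y + b • (nm J m η P y *ᵥ y))) (a • y + b • (nm J m η P y *ᵥ y)) =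
    (a ^ 2 - b ^ 2 * pq J m η P y) * bf J (Q *ᵥ y) y := by
  rw [bf_plane]
  have hNQ : nm J m η P y * Q = - (Q * nm J m η P y) := by
    unfold nm
    rw [Finset.sum_mul, Finset.mul_sum, ← Finset.sum_neg_distrib]
    refine Finset.sum_congr rfl fun j hj => ?_
    rw [Matrix.smul_mul, hQP j (Finset.mem_range.1 hj)]; simp
  set N := nm J m η P y with hN
  have e1 : bf J (Q *ᵥ y) (N *ᵥ y) + bf J (Q *ᵥ (N *ᵥ y)) y = 0 := by
    rw [← bf_adj h.JJ (nm_sym h y), ← bf_add_left, mulVec_mulVec, mulVec_mulVec, ← add_mulVec,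
      hNQ]
    simp [bf]
  have e2 : bf J (Q *ᵥ (N *ᵥ y)) (N *ᵥ y) = - pq J m η P y * bf J (Q *ᵥ y) y := by
    rw [← bf_adj h.JJ (nm_sym h y), mulVec_mulVec, mulVec_mulVec, ← hN, hNQ,
      Matrix.neg_mul, Matrix.mul_assoc, nm_sq h, Matrix.mul_smul, Matrix.mul_one, neg_mulVec,
      smul_mulVec, bf_neg_left, bf_smul_left]
    ring
  rw [e1, e2]; ring

end basics

section algebra
variable {n : ℕ} {J : Matrix (Fin n) (Fin n) ℝ} {m : ℕ} {η : ℕ → ℝ}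
  {P : ℕ → Matrix (Fin n) (Fin n) ℝ}

/-- ordered product of the first `k` matrices -/
def qprod (P : ℕ → Matrix (Fin n) (Fin n) ℝ) : ℕ → Matrix (Fin n) (Fin n) ℝ
  | 0 => 1
  | k + 1 => qprod P k * P k

lemma qprod_comm_ge (h : CliffData n J m η P) {k j : ℕ} (hkj : k ≤ j) (hj : j < m) :
    P j * qprod P k = (-1 : ℝ) ^ k • (qprod P k * P j) := by
  induction k with
  | zero => simp [qprod]
  | succ k ih =>
    rw [qprod, ← Matrix.mul_assoc, ih (by omega), Matrix.smul_mul, Matrix.mul_assoc,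
      h.anti j hj k (by omega) (by omega), pow_succ, Matrix.mul_assoc]
    simp

lemma qprod_comm_lt (h : CliffData n J m η P) {k j : ℕ} (hkj : j < k) (hk : k ≤ m) :
    P j * qprod P k = (-1 : ℝ) ^ (k + 1) • (qprod P k * P j) := by
  induction k with
  | zero => omega
  | succ k ih =>
    rcases Nat.lt_succ_iff_lt_or_eq.1 hkj with hlt | rfl
    · rw [qprod, ← Matrix.mul_assoc, ih hlt (by omega), Matrix.smul_mul, Matrix.mul_assoc,
        h.anti j (by omega) k (by omega) (by omega), pow_succ _ (k+1), Matrix.mul_assoc]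
      simp
    · rw [qprod, ← Matrix.mul_assoc, qprod_comm_ge h le_rfl (by omega), Matrix.smul_mul]
      congr 1; ring

lemma qprod_sym (h : CliffData n J m η P) {k : ℕ} (hk : k ≤ m) :
    (qprod P k)ᵀ = (-1 : ℝ) ^ (k * (k - 1) / 2) • (J * qprod P k * J) := by
  induction k with
  | zero => simp [qprod, h.JJ]
  | succ k ih =>
    rw [qprod, transpose_mul, h.sym k (by omega), ih (by omega)]
    have e : (k + 1) * (k + 1 - 1) / 2 = k * (k - 1) / 2 + k := by
      rcases k with _ | k
      · simp
      · simp only [Nat.add_sub_cancel]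
        rw [show (k + 1 + 1) * (k + 1) = (k+1) * k + (k+1) * 2 by ring,
          Nat.add_mul_div_right _ _ (by norm_num)]
    have e2 : J * P k * J * (J * qprod P k * J) = J * (P k * qprod P k) * J := by
      calc J * P k * J * (J * qprod P k * J) = J * P k * (J * J) * qprod P k * J := by noncomm_ring
        _ = _ := by rw [h.JJ]; noncomm_ring
    rw [Matrix.mul_smul, e2, qprod_comm_ge h le_rfl (by omega), e, pow_add]
    simp [smul_smul]

lemma qprod_sq (h : CliffData n J m η P) {k : ℕ} (hk : k ≤ m) :
    qprod P k * qprod P k =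
      ((-1 : ℝ) ^ (k * (k - 1) / 2) * ∏ j ∈ Finset.range k, η j) •
        (1 : Matrix (Fin n) (Fin n) ℝ) := by
  induction k with
  | zero => simp [qprod]
  | succ k ih =>
    have e : (k + 1) * (k + 1 - 1) / 2 = k * (k - 1) / 2 + k := by
      rcases k with _ | k
      · simp
      · simp only [Nat.add_sub_cancel]
        rw [show (k + 1 + 1) * (k + 1) = (k+1) * k + (k+1) * 2 by ring,
          Nat.add_mul_div_right _ _ (by norm_num)]
    have e3 : qprod P (k+1) * qprod P (k+1) = qprod P k * (P k * qprod P k) * P k := by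
      simp only [qprod]; noncomm_ring
    rw [e3, qprod_comm_ge h le_rfl (by omega), e, pow_add, Finset.prod_range_succ]
    rw [Matrix.mul_smul, Matrix.smul_mul, ← Matrix.mul_assoc, ih (by omega), Matrix.mul_assoc,
      h.sq k (by omega)]
    simp only [smul_mul_assoc, Matrix.mul_smul, smul_smul, Matrix.mul_one]
    congr 1; ring

lemma trace_PP (h : CliffData n J m η P) {i j : ℕ} (hi : i < m) (hj : j < m) :
    trace (P i * P j) = if i = j then η i * n else 0 := by
  split_ifs with e
  · subst e; rw [h.sq i hi]; simp
  · have := congrArg trace (h.anti i hi j hj e)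
    rw [trace_neg, trace_mul_comm (P j)] at this
    linarith

lemma trace_anti (h : CliffData n J m η P) {Q : Matrix (Fin n) (Fin n) ℝ} {j : ℕ} (hj : j < m)
    (hQ : P j * Q = - (Q * P j)) : trace Q = 0 := by
  have h1 : trace (P j * Q * P j) = - trace (P j * Q * P j) := by
    conv_lhs => rw [hQ]
    rw [Matrix.neg_mul, trace_neg, trace_mul_comm (P j * Q), ← Matrix.mul_assoc,
      trace_mul_comm (P j * P j), ← Matrix.mul_assoc]
  have h2 : trace (P j * Q * P j) = η j * trace Q := by
    rw [trace_mul_comm, ← Matrix.mul_assoc, h.sq j hj]; simp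
  have h3 : η j * trace Q = 0 := by linarith
  have := h.ηsq j
  rcases mul_eq_zero.1 h3 with h0 | h0
  · rw [h0] at this; simp at this
  · exact h0

/-- commuting involutions: the sum of `k` of them has no eigenvalue above `k`. -/
lemma invol_sum {X : Type*} [AddCommGroup X] [Module ℝ X] (C : ℕ → X →ₗ[ℝ] X) (k : ℕ)
    (hinv : ∀ j < k, ∀ M, C j (C j M) = M)
    (hcomm : ∀ i < k, ∀ j < k, ∀ M, C i (C j M) = C j (C i M))
    (lam : ℝ) (hlam : (k : ℝ) < lam) (M : X) (hM : ∑ j ∈ Finset.range k, C j M = lam • M) :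
    M = 0 := by
  induction k generalizing lam M with
  | zero =>
    simp only [Finset.range_zero, Finset.sum_empty] at hM
    have : lam ≠ 0 := by simp at hlam; exact hlam.ne'
    exact (smul_eq_zero.1 hM.symm).resolve_left this
  | succ k ih =>
    rw [Finset.sum_range_succ] at hM
    push_cast at hlam
    have hM' : ∑ j ∈ Finset.range k, C j M = lam • M - C k M := by rw [← hM]; abel
    have hCM : ∑ j ∈ Finset.range k, C j (C k M) = lam • C k M - M := by
      have : ∑ j ∈ Finset.range k, C j (C k M) = C k (∑ j ∈ Finset.range k, C j M) := by
        rw [map_sum]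
        refine Finset.sum_congr rfl fun j hj => ?_
        have := Finset.mem_range.1 hj
        exact hcomm j (by omega) k (by omega) M
      rw [this, hM', map_sub, map_smul, hinv k (by omega)]
    have ih' := ih (fun j hj => hinv j (by omega))
      (fun i hi j hj => hcomm i (by omega) j (by omega))
    have hp := ih' (lam - 1) (by linarith) (M + C k M) (by
      simp only [map_add, Finset.sum_add_distrib, hM', hCM]; module)
    have hm := ih' (lam + 1) (by linarith) (M - C k M) (by
      simp only [map_sub, Finset.sum_sub_distrib, hM', hCM]; module)
    have : (2:ℝ) • M = (M + C k M) + (M - C k M) := by module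
    rw [hp, hm, add_zero] at this
    exact (smul_eq_zero.1 this).resolve_left two_ne_zero

/-- symmetric matrices are determined by their quadratic forms -/
lemma sym_ext {X Y : Matrix (Fin n) (Fin n) ℝ} (hX : Xᵀ = X) (hY : Yᵀ = Y)
    (h : ∀ x : Fin n → ℝ, x ⬝ᵥ (X *ᵥ x) = x ⬝ᵥ (Y *ᵥ x)) : X = Y := by
  have key : ∀ (Z : Matrix (Fin n) (Fin n) ℝ) (a b : Fin n),
      (Pi.single a 1 + Pi.single b 1) ⬝ᵥ (Z *ᵥ (Pi.single a 1 + Pi.single b 1)) =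
      Z a a + Z a b + Z b a + Z b b := by
    intro Z a b
    simp [mulVec_add, dotProduct_add, add_dotProduct]; ring
  have d : ∀ a, X a a = Y a a := by
    intro a
    have := h (Pi.single a 1)
    simpa using this
  ext a b
  have e := h (Pi.single a 1 + Pi.single b 1)
  rw [key, key, d, d] at e
  have e1 : X b a = X a b := by conv_lhs => rw [← hX, transpose_apply]
  have e2 : Y b a = Y a b := by conv_lhs => rw [← hY, transpose_apply]
  rw [e1, e2] at e
  linarith

/-- polarization of the quartic identity -/
lemma pq_polar (x y : Fin n → ℝ) (h : ∀ j < m, (P j)ᵀ = J * P j * J) (hJ : J * J = 1)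
    (hJt : Jᵀ = J) :
    pq J m η P (x + y) + pq J m η P (x - y) - 2 * pq J m η P x - 2 * pq J m η P y =
      4 * ∑ j ∈ Finset.range m, η j * (bf J (P j *ᵥ x) x * bf J (P j *ᵥ y) y
        + 2 * bf J (P j *ᵥ x) y ^ 2) := by
  unfold pq
  rw [Finset.mul_sum, Finset.mul_sum, Finset.mul_sum, ← Finset.sum_add_distrib,
    ← Finset.sum_sub_distrib, ← Finset.sum_sub_distrib]
  refine Finset.sum_congr rfl fun j hj => ?_
  have : bf J (P j *ᵥ y) x = bf J (P j *ᵥ x) y := by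
    rw [bf_adj hJ (h j (Finset.mem_range.1 hj)), bf_comm hJt]
  simp only [mulVec_add, mulVec_sub, bf_add_left, bf_add_right, bf_sub_left, bf_sub_right, this]
  ring

lemma JP_sym {M : Matrix (Fin n) (Fin n) ℝ} (hJ : J * J = 1) (hJt : Jᵀ = J)
    (hM : Mᵀ = J * M * J) : (J * M)ᵀ = J * M := by
  rw [transpose_mul, hM, hJt, Matrix.mul_assoc, hJ, Matrix.mul_one]

/-- equality of quartic forms gives equality of second order operators -/
lemma pq_eq_hess {P' : ℕ → Matrix (Fin n) (Fin n) ℝ} (hJ : J * J = 1) (hJt : Jᵀ = J)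
    (h : ∀ j < m, (P j)ᵀ = J * P j * J)
    (h' : ∀ j < m, (P' j)ᵀ = J * P' j * J)
    (hp : ∀ x, pq J m η P x = pq J m η P' x) (X : Matrix (Fin n) (Fin n) ℝ)
    (hX : Xᵀ = J * X * J) :
    ∑ j ∈ Finset.range m, η j • (trace (P j * X) • P j + (2:ℝ) • (P j * X * P j)) =
    ∑ j ∈ Finset.range m, η j • (trace (P' j * X) • P' j + (2:ℝ) • (P' j * X * P' j)) := by
  -- step 1
  have s1 : ∀ x y, ∑ j ∈ Finset.range m, η j * (bf J (P j *ᵥ x) x * bf J (P j *ᵥ y) y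
        + 2 * bf J (P j *ᵥ x) y ^ 2) =
      ∑ j ∈ Finset.range m, η j * (bf J (P' j *ᵥ x) x * bf J (P' j *ᵥ y) y
        + 2 * bf J (P' j *ᵥ x) y ^ 2) := by
    intro x y
    have e1 := pq_polar (η := η) x y h hJ hJt
    have e2 := pq_polar (η := η) x y h' hJ hJt
    rw [hp, hp, hp, hp] at e1
    linarith
  -- matrices
  let H : (ℕ → Matrix (Fin n) (Fin n) ℝ) → (Fin n → ℝ) → Matrix (Fin n) (Fin n) ℝ := fun R x =>
    ∑ j ∈ Finset.range m, η j • (bf J (R j *ᵥ x) x • (J * R j)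
      + (2:ℝ) • vecMulVec ((J * R j) *ᵥ x) ((J * R j) *ᵥ x))
  have Hsym : ∀ (R : ℕ → Matrix (Fin n) (Fin n) ℝ), (∀ j < m, (R j)ᵀ = J * R j * J) → ∀ x,
      (H R x)ᵀ = H R x := by
    intro R hR x
    simp only [H, transpose_sum]
    refine Finset.sum_congr rfl fun j hj => ?_
    rw [transpose_smul, transpose_add, transpose_smul, transpose_smul,
      JP_sym hJ hJt (hR j (Finset.mem_range.1 hj)), transpose_vecMulVec]
  have bfJ : ∀ (R : Matrix (Fin n) (Fin n) ℝ) (x y), bf J (R *ᵥ x) y = y ⬝ᵥ ((J * R) *ᵥ x) := by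
    intro R x y
    rw [bf_comm hJt, bf, mulVec_mulVec]
  have Hq : ∀ (R : ℕ → Matrix (Fin n) (Fin n) ℝ) x y, y ⬝ᵥ (H R x *ᵥ y) =
      ∑ j ∈ Finset.range m, η j * (bf J (R j *ᵥ x) x * bf J (R j *ᵥ y) y
        + 2 * bf J (R j *ᵥ x) y ^ 2) := by
    intro R x y
    simp only [H, sum_mulVec, dotProduct_sum]
    refine Finset.sum_congr rfl fun j hj => ?_
    simp only [smul_mulVec, add_mulVec, dotProduct_smul, dotProduct_add, smul_eq_mul,
      vecMulVec_mulVec, bfJ]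
    simp only [op_smul_eq_smul, smul_eq_mul]
    rw [dotProduct_comm _ y]; ring
  have s2 : ∀ x, H P x = H P' x := fun x => sym_ext (Hsym P h x) (Hsym P' h' x) (fun y => by
    rw [Hq, Hq, s1])
  -- step 2
  let Y : (ℕ → Matrix (Fin n) (Fin n) ℝ) → Matrix (Fin n) (Fin n) ℝ := fun R =>
    ∑ j ∈ Finset.range m, η j • (trace (R j * X) • R j + (2:ℝ) • (R j * X * R j))
  have Ysym : ∀ (R : ℕ → Matrix (Fin n) (Fin n) ℝ), (∀ j < m, (R j)ᵀ = J * R j * J) →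
      (J * Y R)ᵀ = J * Y R := by
    intro R hR
    refine JP_sym hJ hJt ?_
    simp only [Y, transpose_sum, Finset.mul_sum, Finset.sum_mul]
    refine Finset.sum_congr rfl fun j hj => ?_
    have e : J * R j * J * (J * X * J) * (J * R j * J) = J * (R j * X * R j) * J := by
      calc J * R j * J * (J * X * J) * (J * R j * J)
          = J * R j * (J * J) * X * (J * J) * R j * J := by noncomm_ring
        _ = _ := by rw [hJ]; noncomm_ring
    rw [transpose_smul, transpose_add, transpose_smul, transpose_smul, transpose_mul,
      transpose_mul, hR j (Finset.mem_range.1 hj), hX, ← Matrix.mul_assoc, e]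
    simp only [Matrix.mul_smul, Matrix.smul_mul, Matrix.mul_add, Matrix.add_mul]
  have Yq : ∀ (R : ℕ → Matrix (Fin n) (Fin n) ℝ), (∀ j < m, (R j)ᵀ = J * R j * J) → ∀ x,
      x ⬝ᵥ ((J * Y R) *ᵥ x) = trace (H R x * (X * J)) := by
    intro R hR x
    simp only [H, Y, Finset.mul_sum, Finset.sum_mul, sum_mulVec, dotProduct_sum, trace_sum]
    refine Finset.sum_congr rfl fun j hj => ?_
    have t1 : trace (J * R j * (X * J)) = trace (R j * X) := by
      rw [← Matrix.mul_assoc, trace_mul_comm, ← Matrix.mul_assoc, ← Matrix.mul_assoc, hJ,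
        Matrix.one_mul]
    have t2 : trace (vecMulVec ((J * R j) *ᵥ x) ((J * R j) *ᵥ x) * (X * J)) =
        x ⬝ᵥ ((J * (R j * X * R j)) *ᵥ x) := by
      have Ss := JP_sym hJ hJt (hR j (Finset.mem_range.1 hj))
      rw [vecMulVec_mul, trace_vecMulVec, dotProduct_comm, ← dotProduct_mulVec, dotProduct_comm,
        dotProduct_mulVec, ← mulVec_transpose, Ss, dotProduct_comm, mulVec_mulVec, mulVec_mulVec]
      congr 2
      calc J * R j * (X * J) * (J * R j) = J * R j * X * (J * J) * R j := by noncomm_ring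
        _ = _ := by rw [hJ]; noncomm_ring
    simp only [Matrix.mul_smul, Matrix.smul_mul, Matrix.mul_add, Matrix.add_mul, trace_smul,
      trace_add, t1, t2, smul_mulVec, add_mulVec, dotProduct_smul, dotProduct_add, smul_eq_mul,
      bfJ]
    ring
  have s3 : J * Y P = J * Y P' := sym_ext (Ysym P h) (Ysym P' h') (fun x => by
    rw [Yq P h, Yq P' h', s2])
  have : J * (J * Y P) = J * (J * Y P') := by rw [s3]
  rwa [← Matrix.mul_assoc, ← Matrix.mul_assoc, hJ, Matrix.one_mul, Matrix.one_mul] at this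

end algebra

section spans
variable {n : ℕ} {J : Matrix (Fin n) (Fin n) ℝ} {m : ℕ} {η : ℕ → ℝ}
  {P : ℕ → Matrix (Fin n) (Fin n) ℝ}

lemma cl_eig (h : CliffData n J m η P) {i : ℕ} (hi : i < m) :
    ∑ j ∈ Finset.range m, η j • (trace (P j * P i) • P j + (2:ℝ) • (P j * P i * P j)) =
      ((n : ℝ) + 2 * (2 - m)) • P i := by
  have hterm : ∀ j ∈ Finset.range m,
      η j • (trace (P j * P i) • P j + (2:ℝ) • (P j * P i * P j)) =
      (if j = i then ((n:ℝ) + 4) • P i else 0) - (2:ℝ) • P i := by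
    intro j hj
    have hj' := Finset.mem_range.1 hj
    rw [trace_PP h hj' hi]
    by_cases e : j = i
    · subst e
      rw [if_pos rfl, if_pos rfl, h.sq j hj', Matrix.smul_mul, Matrix.one_mul, smul_smul,
        ← add_smul, smul_smul, ← sub_smul]
      congr 1
      linear_combination ((n:ℝ) + 2) * h.ηsq j
    · rw [if_neg e, if_neg e, h.anti j hj' i hi e, Matrix.neg_mul, Matrix.mul_assoc, h.sq j hj']
      simp only [zero_smul, zero_add, Matrix.mul_smul, Matrix.mul_one, smul_neg, smul_smul,
        zero_sub]
      congr 2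
      linear_combination 2 * h.ηsq j
  rw [Finset.sum_congr rfl hterm, Finset.sum_sub_distrib, Finset.sum_ite_eq' (Finset.range m) i,
    if_pos (Finset.mem_range.2 hi), Finset.sum_const, Finset.card_range]
  module

lemma conj_adj (h : CliffData n J m η P) {C C' : Matrix (Fin n) (Fin n) ℝ} (hC : C * C' = 1)
    (hO : Cᵀ * J * C = J) : C'ᵀ = J * C * J := by
  have e1 : Cᵀ * J = J * C' := by
    calc Cᵀ * J = Cᵀ * J * (C * C') := by rw [hC, Matrix.mul_one]
      _ = (Cᵀ * J * C) * C' := by noncomm_ring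
      _ = _ := by rw [hO]
  have e2 := congrArg transpose e1
  rw [transpose_mul, transpose_mul, transpose_transpose, h.Jt] at e2
  calc C'ᵀ = C'ᵀ * (J * J) := by rw [h.JJ, Matrix.mul_one]
    _ = J * C * J := by rw [← Matrix.mul_assoc, ← e2]

lemma conj_cliff (h : CliffData n J m η P) {C C' : Matrix (Fin n) (Fin n) ℝ} (hC : C * C' = 1)
    (hO : Cᵀ * J * C = J) : CliffData n J m η (fun j => C' * P j * C) := by
  have hA := conj_adj h hC hO
  have hA' : Cᵀ = J * C' * J := by
    have := congrArg transpose hA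
    rw [transpose_transpose, transpose_mul, transpose_mul, h.Jt] at this
    rw [this]
    calc Cᵀ = (J * J) * Cᵀ * (J * J) := by rw [h.JJ]; simp
      _ = _ := by noncomm_ring
  have mulc : ∀ X Y : Matrix (Fin n) (Fin n) ℝ, C' * X * C * (C' * Y * C) = C' * (X * Y) * C := by
    intro X Y
    calc C' * X * C * (C' * Y * C) = C' * X * (C * C') * Y * C := by noncomm_ring
      _ = _ := by rw [hC]; noncomm_ring
  have hC' : C' * C = 1 := mul_eq_one_comm.1 hC
  refine ⟨h.Jt, h.JJ, h.ηsq, ?_, ?_, ?_⟩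
  · intro i hi
    simp only [transpose_mul, hA, hA', h.sym i hi]
    calc J * C' * J * (J * P i * J * (J * C * J))
        = J * C' * (J * J) * P i * (J * J) * C * J := by noncomm_ring
      _ = _ := by rw [h.JJ]; noncomm_ring
  · intro i hi
    rw [mulc, h.sq i hi, Matrix.mul_smul, Matrix.smul_mul, Matrix.mul_one, hC']
  · intro i hi j hj hne
    rw [mulc, mulc, h.anti i hi j hj hne, Matrix.mul_neg, Matrix.neg_mul]

lemma pq_conj (h : CliffData n J m η P) {C C' : Matrix (Fin n) (Fin n) ℝ} (hC : C * C' = 1)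
    (hO : Cᵀ * J * C = J) (x : Fin n → ℝ) :
    pq J m η (fun j => C' * P j * C) x = pq J m η P (C *ᵥ x) := by
  unfold pq
  refine Finset.sum_congr rfl fun j _ => ?_
  show η j * bf J ((C' * P j * C) *ᵥ x) x ^ 2 = _
  rw [Matrix.mul_assoc, ← mulVec_mulVec, bf_adj h.JJ (conj_adj h hC hO), ← mulVec_mulVec]

lemma conj_mem_span (h : CliffData n J m η P) (hbig : 4 * m < n + 4)
    {C C' : Matrix (Fin n) (Fin n) ℝ} (hC : C * C' = 1)
    (hO : Cᵀ * J * C = J) (hp : ∀ x, pq J m η P (C *ᵥ x) = pq J m η P x) {i : ℕ} (hi : i < m) :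
    C' * P i * C ∈ Submodule.span ℝ (P '' Set.Iio m) := by
  have h' := conj_cliff h hC hO
  set P' : ℕ → Matrix (Fin n) (Fin n) ℝ := fun j => C' * P j * C with hP'
  have hpp : ∀ x, pq J m η P x = pq J m η P' x := fun x => by
    rw [hP', pq_conj h hC hO, hp]
  have key := pq_eq_hess h.JJ h.Jt h.sym h'.sym hpp (P' i) (h'.sym i hi)
  rw [cl_eig h' hi] at key
  -- the operator
  have hn0 : (n : ℝ) ≠ 0 := by
    have : n ≠ 0 := by omega
    exact_mod_cast this
  let co : ℕ → ℝ := fun k => η k * trace (P k * P' i) / n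
  set S : Matrix (Fin n) (Fin n) ℝ := ∑ k ∈ Finset.range m, co k • P k with hS
  have trS : ∀ j < m, trace (P j * S) = trace (P j * P' i) := by
    intro j hj
    rw [hS, Finset.mul_sum, trace_sum]
    rw [Finset.sum_eq_single_of_mem j (Finset.mem_range.2 hj)]
    · rw [Matrix.mul_smul, trace_smul, trace_PP h hj hj, if_pos rfl, smul_eq_mul]
      simp only [co]
      field_simp
      linear_combination (trace (P j * P' i)) * h.ηsq j
    · intro k hk hne
      rw [Matrix.mul_smul, trace_smul, trace_PP h hj (Finset.mem_range.1 hk), if_neg (Ne.symm hne),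
        smul_zero]
  have eigS : ∑ j ∈ Finset.range m, η j • (trace (P j * S) • P j + (2:ℝ) • (P j * S * P j)) =
      ((n : ℝ) + 2 * (2 - m)) • S := by
    have : ∀ k ∈ Finset.range m, co k • ((n : ℝ) + 2 * (2 - m)) • P k =
        ∑ j ∈ Finset.range m, co k • η j • (trace (P j * P k) • P j
          + (2:ℝ) • (P j * P k * P j)) := by
      intro k hk
      rw [← Finset.smul_sum, cl_eig h (Finset.mem_range.1 hk)]
    conv_rhs => rw [hS, Finset.smul_sum]
    simp_rw [smul_comm _ (co _)]
    rw [Finset.sum_congr rfl this, Finset.sum_comm]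
    refine Finset.sum_congr rfl fun j hj => ?_
    rw [hS]
    simp_rw [smul_comm (co _) (η j)]
    rw [← Finset.smul_sum]
    congr 1
    simp only [smul_add, Finset.sum_add_distrib, Finset.mul_sum, Finset.sum_mul, trace_sum,
      Finset.sum_smul, Finset.smul_sum, Matrix.mul_smul, Matrix.smul_mul, trace_smul, smul_eq_mul,
      smul_smul, mul_comm]
  let Cj : ℕ → Matrix (Fin n) (Fin n) ℝ →ₗ[ℝ] Matrix (Fin n) (Fin n) ℝ := fun j =>
    { toFun := fun M => η j • (P j * M * P j)
      map_add' := fun x y => by simp [Matrix.mul_add, Matrix.add_mul]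
      map_smul' := fun a x => by simp [smul_comm a] }
  have hM : P' i - S = 0 := by
    refine invol_sum Cj m ?_ ?_ ((n:ℝ)/2 + 2 - m) ?_ (P' i - S) ?_
    · intro j hj M
      simp only [Cj, LinearMap.coe_mk, AddHom.coe_mk]
      have : P j * (η j • (P j * M * P j)) * P j = η j • ((P j * P j) * M * (P j * P j)) := by
        simp only [Matrix.mul_smul, Matrix.smul_mul, Matrix.mul_assoc]
      rw [this, h.sq j hj]
      simp [smul_smul, h.ηsq j]
    · intro j hj k hk M
      simp only [Cj, LinearMap.coe_mk, AddHom.coe_mk]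
      by_cases e : j = k
      · rw [e]
      · have e1 := h.anti j hj k hk e
        have : P j * P k * M * (P k * P j) = P k * P j * M * (P j * P k) := by
          rw [e1, h.anti k hk j hj (Ne.symm e)]; simp [e1]
        simp only [Matrix.mul_smul, Matrix.smul_mul]
        rw [smul_comm]
        congr 2
        simpa [Matrix.mul_assoc] using this
    · have : (4 * m : ℝ) < n + 4 := by exact_mod_cast hbig
      linarith
    · have e := sub_eq_zero.2 (key.trans rfl)
      have e2 : ∑ j ∈ Finset.range m, (2:ℝ) • Cj j (P' i - S) =
          ((n : ℝ) + 2 * (2 - m)) • (P' i - S) := by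
        rw [smul_sub, ← key, ← eigS, ← Finset.sum_sub_distrib]
        refine Finset.sum_congr rfl fun j hj => ?_
        rw [trS j (Finset.mem_range.1 hj)]
        simp only [Cj, LinearMap.coe_mk, AddHom.coe_mk, Matrix.mul_sub, Matrix.sub_mul]
        module
      rw [← Finset.smul_sum] at e2
      have e3 : (2:ℝ) • ∑ j ∈ Finset.range m, Cj j (P' i - S) =
          (2:ℝ) • (((n:ℝ)/2 + 2 - m) • (P' i - S)) := by
        rw [e2, smul_smul]; congr 1; ring
      exact smul_right_injective _ two_ne_zero e3
  have : C' * P i * C = S := sub_eq_zero.1 hM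
  rw [this, hS]
  refine Submodule.sum_mem _ fun k hk => Submodule.smul_mem _ _ (Submodule.subset_span ?_)
  exact ⟨k, Finset.mem_range.1 hk, rfl⟩

/-- even and odd parts of the Clifford algebra (`true` is even) -/
def evod (P : ℕ → Matrix (Fin n) (Fin n) ℝ) : ℕ → Bool → Matrix (Fin n) (Fin n) ℝ → Prop
  | 0, true, Y => ∃ a : ℝ, Y = a • 1
  | 0, false, Y => Y = 0
  | k + 1, b, Y => ∃ U V, evod P k b U ∧ evod P k (!b) V ∧ Y = U + V * P k

lemma evod_zero : ∀ k b, evod P k b 0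
  | 0, true => ⟨0, by simp⟩
  | 0, false => rfl
  | k + 1, b => ⟨0, 0, evod_zero k b, evod_zero k _, by simp⟩

lemma evod_add : ∀ k b Y Z, evod P k b Y → evod P k b Z → evod P k b (Y + Z)
  | 0, true, Y, Z, ⟨a, ha⟩, ⟨c, hc⟩ => ⟨a + c, by rw [ha, hc, add_smul]⟩
  | 0, false, Y, Z, hY, hZ => by
      simp only [evod] at *; rw [hY, hZ, add_zero]
  | k + 1, b, Y, Z, ⟨U, V, hU, hV, e⟩, ⟨U', V', hU', hV', e'⟩ =>
      ⟨U + U', V + V', evod_add k _ _ _ hU hU', evod_add k _ _ _ hV hV', by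
        rw [e, e', Matrix.add_mul]; abel⟩

lemma evod_smul (c : ℝ) : ∀ k b Y, evod P k b Y → evod P k b (c • Y)
  | 0, true, Y, ⟨a, ha⟩ => ⟨c * a, by rw [ha, smul_smul]⟩
  | 0, false, Y, hY => by
      simp only [evod] at *; rw [hY, smul_zero]
  | k + 1, b, Y, ⟨U, V, hU, hV, e⟩ =>
      ⟨c • U, c • V, evod_smul c k _ _ hU, evod_smul c k _ _ hV, by
        rw [e, smul_add, Matrix.smul_mul]⟩

lemma evod_mul (h : CliffData n J m η P) : ∀ k ≤ m, ∀ b Y j, j < k → evod P k b Y →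
    evod P k (!b) (Y * P j)
  | 0, _, b, Y, j, hj, _ => by omega
  | k + 1, hk, b, Y, j, hj, ⟨U, V, hU, hV, e⟩ => by
      rcases Nat.lt_succ_iff_lt_or_eq.1 hj with hlt | rfl
      · refine ⟨U * P j, -(V * P j), evod_mul h k (by omega) _ _ _ hlt hU, ?_, ?_⟩
        · have := evod_smul (-1) _ _ _ (evod_mul h k (by omega) _ _ _ hlt hV)
          simpa using this
        · rw [e, Matrix.add_mul, Matrix.mul_assoc V, h.anti k (by omega) j (by omega) (by omega)]
          simp [Matrix.mul_assoc]
      · refine ⟨η j • V, U, evod_smul _ _ _ _ hV, by simpa using hU, ?_⟩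
        rw [e, Matrix.add_mul, Matrix.mul_assoc V, h.sq j (by omega)]
        simp [add_comm]

lemma evod_comm (h : CliffData n J m η P) : ∀ k b Y j, k ≤ j → j < m → evod P k b Y →
    P j * Y = (if b then (1:ℝ) else -1) • (Y * P j)
  | 0, true, Y, j, _, _, ⟨a, ha⟩ => by rw [ha]; simp
  | 0, false, Y, j, _, _, hY => by simp only [evod] at hY; rw [hY]; simp
  | k + 1, b, Y, j, hkj, hj, ⟨U, V, hU, hV, e⟩ => by
      have e1 := evod_comm h k b U j (by omega) hj hU
      have e2 := evod_comm h k (!b) V j (by omega) hj hV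
      rw [e, Matrix.mul_add, ← Matrix.mul_assoc, e1, e2, Matrix.smul_mul, Matrix.mul_assoc,
        h.anti j hj k (by omega) (by omega)]
      cases b <;> simp [Matrix.add_mul, Matrix.mul_assoc]

lemma evod_scalar (h : CliffData n J m η P) : ∀ k ≤ m, ∀ Y, evod P k true Y →
    (∀ j < k, P j * Y = Y * P j) → ∃ a : ℝ, Y = a • (1 : Matrix (Fin n) (Fin n) ℝ)
  | 0, _, Y, hY, _ => hY
  | k + 1, hk, Y, ⟨U, V, hU, hV, e⟩, hc => by
      have e1 := evod_comm h k true U k le_rfl (by omega) hU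
      have e2 := evod_comm h k false V k le_rfl (by omega) hV
      simp only [if_true, one_smul] at e1
      have e2' : P k * V = -(V * P k) := by simpa using e2
      have e3 := hc k (by omega)
      rw [e, Matrix.mul_add, Matrix.add_mul, e1, ← Matrix.mul_assoc, e2', Matrix.neg_mul] at e3
      have e4 : (2:ℝ) • (V * P k * P k) = 0 := by
        have := add_left_cancel e3
        rw [two_smul]
        nth_rewrite 1 [← this]; simp
      have e5 : V * P k * P k = 0 := (smul_eq_zero.1 e4).resolve_left two_ne_zero
      have e6 : V * P k = 0 := by
        have : V * P k * P k * P k = η k • (V * P k) := by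
          rw [Matrix.mul_assoc (V * P k), h.sq k (by omega)]; simp
        rw [e5, Matrix.zero_mul] at this
        refine (smul_eq_zero.1 this.symm).resolve_left fun h0 => ?_
        have := h.ηsq k
        rw [h0] at this; simp at this
      have hYU : Y = U := by rw [e, e6, add_zero]
      rw [hYU]
      exact evod_scalar h k (by omega) U hU fun j hj => by rw [← hYU]; exact hc j (by omega)

lemma evod_mul_span (h : CliffData n J m η P) {b : Bool} {Y R : Matrix (Fin n) (Fin n) ℝ}
    (hY : evod P m b Y) (hR : R ∈ Submodule.span ℝ (P '' Set.Iio m)) : evod P m (!b) (Y * R) := by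
  induction hR using Submodule.span_induction with
  | mem x hx => obtain ⟨j, hj, rfl⟩ := hx; exact evod_mul h m le_rfl b Y j hj hY
  | zero => rw [Matrix.mul_zero]; exact evod_zero _ _
  | add x y _ _ hx hy => rw [Matrix.mul_add]; exact evod_add _ _ _ _ hx hy
  | smul a x _ hx => rw [Matrix.mul_smul]; exact evod_smul _ _ _ _ hx

lemma evod_mul_qprod (h : CliffData n J m η P) {Y : Matrix (Fin n) (Fin n) ℝ}
    {R : ℕ → Matrix (Fin n) (Fin n) ℝ}
    (hY : evod P m true Y) (k : ℕ) (hR : ∀ j < k, R j ∈ Submodule.span ℝ (P '' Set.Iio m)) :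
    evod P m (decide (k % 2 = 0)) (Y * qprod R k) := by
  induction k with
  | zero => simpa [qprod] using hY
  | succ k ih =>
    have := evod_mul_span h (ih fun j hj => hR j (by omega)) (hR k (by omega))
    rw [qprod, ← Matrix.mul_assoc]
    convert this using 1
    rcases Nat.mod_two_eq_zero_or_one k with e | e <;> simp [e, Nat.add_mod]

lemma evod_one : ∀ k, evod P k true 1
  | 0 => ⟨1, by simp⟩
  | k + 1 => ⟨1, 0, evod_one k, evod_zero k _, by simp⟩

lemma qprod_conj {C C' : Matrix (Fin n) (Fin n) ℝ} (hC : C * C' = 1) (k : ℕ) :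
    qprod (fun j => C' * P j * C) k = C' * qprod P k * C := by
  induction k with
  | zero => simp [qprod, mul_eq_one_comm.1 hC]
  | succ k ih =>
    simp only [qprod]
    rw [ih]
    calc C' * qprod P k * C * (C' * P k * C) = C' * qprod P k * (C * C') * P k * C := by
          noncomm_ring
      _ = _ := by rw [hC]; noncomm_ring

/-- the volume element is preserved up to sign -/
lemma h_invariant (h : CliffData n J m η P) (hbig : 4 * m < n + 4) (hm : m % 2 = 0)
    (hQ2 : qprod P m * qprod P m = 1)
    {C C' : Matrix (Fin n) (Fin n) ℝ} (hC : C * C' = 1)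
    (hO : Cᵀ * J * C = J) (hp : ∀ x, pq J m η P (C *ᵥ x) = pq J m η P x) (x : Fin n → ℝ) :
    bf J (qprod P m *ᵥ (C *ᵥ x)) (C *ᵥ x) ^ 2 = bf J (qprod P m *ᵥ x) x ^ 2 := by
  have hC' : C' * C = 1 := mul_eq_one_comm.1 hC
  have hO' : C'ᵀ * J * C' = J := by
    rw [conj_adj h hC hO]
    calc J * C * J * J * C' = J * (C * (J * J) * C') := by noncomm_ring
      _ = J := by rw [h.JJ, Matrix.mul_one, hC, Matrix.mul_one]
  have hp' : ∀ x, pq J m η P (C' *ᵥ x) = pq J m η P x := fun x => by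
    rw [← hp, mulVec_mulVec, hC, one_mulVec]
  have hQa : ∀ j < m, P j * qprod P m = -(qprod P m * P j) := by
    intro j hj
    rw [qprod_comm_lt h hj le_rfl, pow_succ, Even.neg_one_pow (Nat.even_iff.2 hm)]; simp
  have hQs : ∀ R ∈ Submodule.span ℝ (P '' Set.Iio m), R * qprod P m = -(qprod P m * R) := by
    intro R hR
    induction hR using Submodule.span_induction with
    | mem x hx => obtain ⟨j, hj, rfl⟩ := hx; exact hQa j hj
    | zero => simp
    | add x y _ _ hx hy => rw [Matrix.mul_add, Matrix.add_mul, hx, hy]; abel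
    | smul a x _ hx => rw [Matrix.mul_smul, Matrix.smul_mul, hx, smul_neg]
  set Q := qprod P m with hQ
  set Q' := C' * Q * C with hQ'
  have hQ'a : ∀ j < m, P j * Q' = -(Q' * P j) := by
    intro j hj
    have e := hQs _ (conj_mem_span h hbig hC' hO' hp' hj)
    calc P j * Q' = (C' * C) * P j * C' * Q * C := by rw [hC', hQ']; noncomm_ring
      _ = C' * ((C * P j * C') * Q) * C := by noncomm_ring
      _ = - (C' * Q * C * P j * (C' * C)) := by rw [e]; noncomm_ring
      _ = _ := by rw [hC', Matrix.mul_one]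
  have hev : evod P m true (Q * Q') := by
    have h1 : evod P m true Q := by
      have := evod_mul_qprod h (evod_one m) m (R := P)
        (fun j hj => Submodule.subset_span ⟨j, hj, rfl⟩)
      simpa [hm] using this
    have := evod_mul_qprod h h1 m (R := fun j => C' * P j * C)
        (fun j hj => conj_mem_span h hbig hC hO hp hj)
    rw [qprod_conj hC] at this
    simpa [hm] using this
  obtain ⟨z, hz⟩ := evod_scalar h m le_rfl _ hev (fun j hj => by
    rw [← Matrix.mul_assoc, hQa j hj, Matrix.neg_mul, Matrix.mul_assoc, hQ'a j hj]
    simp [Matrix.mul_assoc])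
  have hz' : Q' = z • Q := by
    have : Q * (Q * Q') = z • Q := by rw [hz]; simp
    rwa [← Matrix.mul_assoc, hQ2, Matrix.one_mul] at this
  have hQ'2 : Q' * Q' = 1 := by
    calc Q' * Q' = C' * Q * (C * C') * Q * C := by rw [hQ']; noncomm_ring
      _ = C' * (Q * Q) * C := by rw [hC]; noncomm_ring
      _ = 1 := by rw [hQ2, Matrix.mul_one, hC']
  have e : bf J (Q *ᵥ (C *ᵥ x)) (C *ᵥ x) = z * bf J (Q *ᵥ x) x := by
    rw [← bf_adj h.JJ (conj_adj h hC hO), mulVec_mulVec, mulVec_mulVec,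
      ← hQ', hz', smul_mulVec, bf_smul_left]
  rw [e]
  rcases isEmpty_or_nonempty (Fin n) with hn | ⟨⟨i⟩⟩
  · have : bf J (Q *ᵥ x) x = 0 := by simp [bf, dotProduct]
    rw [this]; simp
  · rw [hz', Matrix.smul_mul, Matrix.mul_smul, hQ2, smul_smul] at hQ'2
    have := congrFun (congrFun hQ'2 i) i
    simp at this
    rw [mul_pow, sq z, this, one_mul]

end spans

section dims

lemma idem_factor {n : ℕ} (E : Matrix (Fin n) (Fin n) ℂ) (hE : E * E = E) :
    ∃ (d : ℕ) (X : Matrix (Fin n) (Fin d) ℂ) (Y : Matrix (Fin d) (Fin n) ℂ),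
      X * Y = E ∧ Y * X = 1 := by
  let f := Matrix.toLin' E
  let W := LinearMap.range f
  let b := Module.finBasis ℂ W
  let s := Pi.basisFun ℂ (Fin n)
  refine ⟨Module.finrank ℂ W, LinearMap.toMatrix b s W.subtype,
    LinearMap.toMatrix s b f.rangeRestrict, ?_, ?_⟩
  · rw [← LinearMap.toMatrix_comp s b s]
    have : W.subtype ∘ₗ f.rangeRestrict = f := by ext; rfl
    rw [this]
    exact LinearMap.toMatrix'_toLin' E
  · rw [← LinearMap.toMatrix_comp b s b]
    have : f.rangeRestrict ∘ₗ W.subtype = LinearMap.id := by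
      apply LinearMap.ext
      rintro ⟨w, v, rfl⟩
      apply Subtype.ext
      show f (f v) = f v
      simp only [f, toLin'_apply, mulVec_mulVec, hE]
    rw [this, LinearMap.toMatrix_id]

/-- partial products of idempotents -/
def eprod {n : ℕ} (ω : ℕ → ℂ) (R : ℕ → Matrix (Fin n) (Fin n) ℂ) :
    ℕ → Matrix (Fin n) (Fin n) ℂ
  | 0 => 1
  | k + 1 => (1/2 : ℂ) • (eprod ω R k * (1 + ω k • (R (2 * k) * R (2 * k + 1))))

variable {n m : ℕ} {η : ℕ → ℂ} {R : ℕ → Matrix (Fin n) (Fin n) ℂ} {ω : ℕ → ℂ}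

lemma eprod_comm (anti : ∀ i < m, ∀ j < m, i ≠ j → R i * R j = -(R j * R i)) (k : ℕ)
    (hk : 2 * k ≤ m) (j : ℕ) (hj : 2 * k ≤ j) (hjm : j < m) :
    R j * eprod ω R k = eprod ω R k * R j := by
  induction k with
  | zero => simp [eprod]
  | succ k ih =>
    have e1 := anti j hjm (2 * k) (by omega) (by omega)
    have e2 := anti j hjm (2 * k + 1) (by omega) (by omega)
    have e3 : R j * (R (2*k) * R (2*k+1)) = R (2*k) * R (2*k+1) * R j := by
      rw [← Matrix.mul_assoc, e1, Matrix.neg_mul, Matrix.mul_assoc, e2]; simp [Matrix.mul_assoc]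
    have e4 : R j * (1 + ω k • (R (2*k) * R (2*k+1))) = (1 + ω k • (R (2*k) * R (2*k+1))) * R j := by
      rw [Matrix.mul_add, Matrix.add_mul, Matrix.mul_smul, Matrix.smul_mul, e3]; simp
    rw [eprod, Matrix.mul_smul, Matrix.smul_mul, ← Matrix.mul_assoc, ih (by omega) (by omega),
      Matrix.mul_assoc, e4, Matrix.mul_assoc]

lemma eprod_idem (anti : ∀ i < m, ∀ j < m, i ≠ j → R i * R j = -(R j * R i))
    (sq : ∀ i < m, R i * R i = η i • (1 : Matrix (Fin n) (Fin n) ℂ))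
    (hω : ∀ k, ω k * ω k * (η (2 * k) * η (2 * k + 1)) = -1) (k : ℕ)
    (hk : 2 * k ≤ m) :
    eprod ω R k * eprod ω R k = eprod ω R k ∧ trace (eprod ω R k) * 2 ^ k = n := by
  induction k with
  | zero => simp [eprod]
  | succ k ih =>
    obtain ⟨i1, i2⟩ := ih (by omega)
    set E := eprod ω R k with hE
    have ca := eprod_comm (ω := ω) anti k (by omega) (2 * k) (by omega) (by omega)
    have cb := eprod_comm (ω := ω) anti k (by omega) (2 * k + 1) (by omega) (by omega)
    have ab := anti (2 * k) (by omega) (2 * k + 1) (by omega) (by omega)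
    have sa := sq (2 * k) (by omega)
    have sb := sq (2 * k + 1) (by omega)
    rw [← hE] at ca cb
    have hw := hω k
    simp only [eprod]
    rw [← hE]
    set a := R (2 * k)
    set b := R (2 * k + 1)
    have cab : (a * b) * E = E * (a * b) := by
      rw [Matrix.mul_assoc, cb, ← Matrix.mul_assoc, ca, Matrix.mul_assoc]
    set G := ω k • (a * b) with hG
    have cG : G * E = E * G := by rw [hG, Matrix.smul_mul, cab, Matrix.mul_smul]
    have GG : G * G = 1 := by
      have : (a * b) * (a * b) = -((η (2 * k) * η (2 * k + 1)) • (1 : Matrix (Fin n) (Fin n) ℂ)) := by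
        calc (a * b) * (a * b) = (a * b) * (-(b * a)) := by rw [← ab]
          _ = -(a * (b * b) * a) := by noncomm_ring
          _ = _ := by rw [sb]; simp [sa, smul_smul, mul_comm]
      rw [hG, Matrix.smul_mul, Matrix.mul_smul, this, smul_smul, smul_neg, smul_smul, hw]
      simp
    have cG1 : (1 + G) * E = E * (1 + G) := by
      rw [Matrix.add_mul, cG, Matrix.mul_add, Matrix.one_mul, Matrix.mul_one]
    constructor
    · have : E * (1 + G) * (E * (1 + G)) = (2:ℂ) • (E * (1 + G)) := by
        calc E * (1 + G) * (E * (1 + G)) = E * ((1 + G) * E) * (1 + G) := by noncomm_ring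
          _ = E * (E * (1 + G)) * (1 + G) := by
              rw [cG1]
          _ = (E * E) * (1 + G + G + G * G) := by noncomm_ring
          _ = _ := by rw [i1, GG, two_smul]; noncomm_ring
      rw [Matrix.smul_mul, Matrix.mul_smul, this, smul_smul, smul_smul]
      congr 1; norm_num
    · have t : trace (E * (a * b)) = 0 := by
        have e1 : trace (E * (a * b)) = trace (E * (b * a)) := by
          rw [← Matrix.mul_assoc, ← ca, Matrix.mul_assoc, trace_mul_comm, Matrix.mul_assoc]
        have e2 : trace (E * (a * b)) = - trace (E * (b * a)) := by
          rw [ab, Matrix.mul_neg, trace_neg]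
        rw [← e1] at e2
        linear_combination (1/2 : ℂ) * e2
      rw [trace_smul, Matrix.mul_add, trace_add, hG, Matrix.mul_smul, trace_smul, t,
        Matrix.mul_one, ← i2, pow_succ]
      simp only [smul_eq_mul]; ring

lemma skew_even {d : ℕ} (M N : Matrix (Fin d) (Fin d) ℂ) (hM : Mᵀ = -M) (h : M * N = 1) :
    d % 2 = 0 := by
  have h1 : M.det * N.det = 1 := by rw [← det_mul, h, det_one]
  have h2 : M.det = (-1) ^ d * M.det := by
    conv_lhs => rw [← det_transpose, hM, det_neg, Fintype.card_fin]
  rcases Nat.mod_two_eq_zero_or_one d with e | e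
  · exact e
  · rw [Odd.neg_one_pow (Nat.odd_iff.2 e)] at h2
    have : M.det = 0 := by linear_combination (1/2 : ℂ) * h2
    rw [this] at h1; simp at h1

lemma dim_big {l m : ℕ} {J : Matrix (Fin (2 * l)) (Fin (2 * l)) ℝ} {η : ℕ → ℝ}
    {P : ℕ → Matrix (Fin (2 * l)) (Fin (2 * l)) ℝ} (h : CliffData (2 * l) J m η P)
    (hm0 : 2 ≤ m) (hm4 : m % 4 = 0) (hlm : m < l) : 4 * m < 2 * l + 4 := by
  let φ : Matrix (Fin (2 * l)) (Fin (2 * l)) ℝ →+* Matrix (Fin (2 * l)) (Fin (2 * l)) ℂ :=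
    Complex.ofRealHom.mapMatrix
  have φs : ∀ (a : ℝ) X, φ (a • X) = (a : ℂ) • φ X := by
    intro a X; ext i j; simp [φ]
  have φt : ∀ X, φ Xᵀ = (φ X)ᵀ := by
    intro X; ext i j; simp [φ]
  let R : ℕ → Matrix (Fin (2 * l)) (Fin (2 * l)) ℂ := fun j => φ (P j)
  have sq : ∀ i < m, R i * R i = (η i : ℂ) • (1 : Matrix (Fin (2 * l)) (Fin (2 * l)) ℂ) := by
    intro i hi
    simp only [R]; rw [← map_mul, h.sq i hi, φs, map_one]
  have anti : ∀ i < m, ∀ j < m, i ≠ j → R i * R j = -(R j * R i) := by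
    intro i hi j hj hne
    simp only [R]; rw [← map_mul, h.anti i hi j hj hne, map_neg, map_mul]
  have hsq : ∀ z : ℂ, ∃ w : ℂ, w * w = z := fun z => by
    obtain ⟨w, hw⟩ := IsAlgClosed.exists_pow_nat_eq z (n := 2) (by norm_num)
    exact ⟨w, by rw [← pow_two, hw]⟩
  choose ω hω using fun k : ℕ => hsq (-((η (2 * k) : ℂ) * (η (2 * k + 1) : ℂ)))
  have hη : ∀ i, (η i : ℂ) * η i = 1 := fun i => by exact_mod_cast h.ηsq i
  have hω' : ∀ k, ω k * ω k * ((η (2 * k) : ℂ) * (η (2 * k + 1) : ℂ)) = -1 := by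
    intro k
    rw [hω]
    linear_combination (-(η (2 * k + 1) : ℂ) * (η (2 * k + 1) : ℂ)) * hη (2 * k) - hη (2 * k + 1)
  obtain ⟨idem, tr⟩ := eprod_idem anti sq hω' (m / 2) (by omega)
  obtain ⟨d, X, Y, hXY, hYX⟩ := idem_factor _ idem
  have htr : trace (eprod ω R (m/2)) = d := by
    rw [← hXY, trace_mul_comm, hYX]; simp
  rw [htr] at tr
  have tr' : d * 2 ^ (m / 2) = 2 * l := by exact_mod_cast tr
  by_cases hm8 : m = 4
  · subst hm8
    have hd : d % 2 = 0 := by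
      let JJ := φ J
      have hJJ : JJ * JJ = 1 := by simp only [JJ]; rw [← map_mul, h.JJ, map_one]
      have hJt : JJᵀ = JJ := by simp only [JJ]; rw [← φt, h.Jt]
      have hRt : ∀ i < 4, (R i)ᵀ = JJ * R i * JJ := by
        intro i hi
        simp only [R, JJ]; rw [← φt, h.sym i hi, map_mul, map_mul]
      let T := R 0 * R 2
      let T' := ((η 0 : ℂ) * (η 2 : ℂ)) • (R 2 * R 0)
      have hT : T * T' = 1 := by
        have : R 0 * R 2 * (R 2 * R 0) = ((η 0 : ℂ) * (η 2 : ℂ)) •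
            (1 : Matrix (Fin (2 * l)) (Fin (2 * l)) ℂ) := by
          calc R 0 * R 2 * (R 2 * R 0) = R 0 * (R 2 * R 2) * R 0 := by noncomm_ring
            _ = _ := by
              rw [sq 2 (by norm_num), Matrix.mul_smul, Matrix.mul_one, Matrix.smul_mul,
                sq 0 (by norm_num), smul_smul, mul_comm (η 2 : ℂ) (η 0 : ℂ)]
        simp only [T, T', Matrix.mul_smul]
        rw [this, smul_smul]
        have e : (η 0 : ℂ) * (η 2 : ℂ) * ((η 0 : ℂ) * (η 2 : ℂ)) = 1 := by
          linear_combination ((η 2 : ℂ) * η 2) * hη 0 + hη 2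
        rw [e, one_smul]
      have hTt : Tᵀ = -(JJ * T * JJ) := by
        simp only [T, transpose_mul, hRt 0 (by norm_num), hRt 2 (by norm_num)]
        calc JJ * R 2 * JJ * (JJ * R 0 * JJ) = JJ * R 2 * (JJ * JJ) * R 0 * JJ := by noncomm_ring
          _ = JJ * (R 2 * R 0) * JJ := by rw [hJJ]; noncomm_ring
          _ = _ := by rw [anti 2 (by norm_num) 0 (by norm_num) (by norm_num)]; noncomm_ring
      have a01 := anti 0 (by norm_num) 1 (by norm_num) (by norm_num)
      have a02 := anti 0 (by norm_num) 2 (by norm_num) (by norm_num)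
      have a03 := anti 0 (by norm_num) 3 (by norm_num) (by norm_num)
      have a12 := anti 1 (by norm_num) 2 (by norm_num) (by norm_num)
      have a13 := anti 1 (by norm_num) 3 (by norm_num) (by norm_num)
      have a23 := anti 2 (by norm_num) 3 (by norm_num) (by norm_num)
      set E := eprod ω R 2 with hE
      have hEE : E = (1/4 : ℂ) • ((1 + ω 0 • (R 0 * R 1)) * (1 + ω 1 • (R 2 * R 3))) := by
        rw [hE]; simp only [eprod, Matrix.one_mul, Matrix.smul_mul, smul_smul]
        norm_num
      have c0 : T * (R 0 * R 1) = -(R 0 * R 1 * T) := by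
        simp only [T]
        calc R 0 * R 2 * (R 0 * R 1) = - (R 2 * R 0) * R 0 * R 1 := by rw [a02]; noncomm_ring
          _ = - R 2 * (R 0 * R 0) * R 1 := by noncomm_ring
          _ = - ((R 0 * R 0) * (R 2 * R 1)) := by rw [sq 0 (by norm_num)]; simp
          _ = - (R 0 * (R 0 * R 2) * R 1) := by noncomm_ring
          _ = - (R 0 * (R 0 * (R 2 * R 1))) := by noncomm_ring
          _ = R 0 * (R 0 * R 1) * R 2 := by
              rw [show R 2 * R 1 = -(R 1 * R 2) by rw [a12]; simp]; noncomm_ring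
          _ = R 0 * (-(R 1 * R 0)) * R 2 := by rw [← a01]
          _ = _ := by noncomm_ring
      have c1 : T * (R 2 * R 3) = -(R 2 * R 3 * T) := by
        simp only [T]
        calc R 0 * R 2 * (R 2 * R 3) = R 0 * R 2 * (-(R 3 * R 2)) := by rw [a23]
          _ = - (R 0 * R 2) * R 3 * R 2 := by noncomm_ring
          _ = R 2 * (R 0 * R 3) * R 2 := by rw [a02]; noncomm_ring
          _ = _ := by rw [a03]; noncomm_ring
      have cG : R 2 * R 3 * (R 0 * R 1) = R 0 * R 1 * (R 2 * R 3) := by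
        calc R 2 * R 3 * (R 0 * R 1) = R 2 * (R 3 * R 0) * R 1 := by noncomm_ring
          _ = R 2 * R 0 * -(R 3 * R 1) := by
            rw [show R 3 * R 0 = -(R 0 * R 3) by rw [a03]; simp]; noncomm_ring
          _ = R 2 * R 0 * R 1 * R 3 := by
            rw [show R 3 * R 1 = -(R 1 * R 3) by rw [a13]; simp]; noncomm_ring
          _ = - (R 0 * (R 2 * R 1) * R 3) := by
            rw [show R 2 * R 0 = -(R 0 * R 2) by rw [a02]; simp]; noncomm_ring
          _ = _ := by
            rw [show R 2 * R 1 = -(R 1 * R 2) by rw [a12]; simp]; noncomm_ring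
      have gt : ∀ i < 4, ∀ j < 4, i ≠ j → (R i * R j)ᵀ = -(JJ * (R i * R j) * JJ) := by
        intro i hi j hj hne
        rw [transpose_mul, hRt i hi, hRt j hj]
        calc JJ * R j * JJ * (JJ * R i * JJ) = JJ * R j * (JJ * JJ) * R i * JJ := by noncomm_ring
          _ = JJ * (R j * R i) * JJ := by rw [hJJ]; noncomm_ring
          _ = _ := by rw [anti j hj i hi (Ne.symm hne)]; noncomm_ring
      have hTE : T * E = JJ * Eᵀ * JJ * T := by
        have e1 : JJ * Eᵀ * JJ = (1/4 : ℂ) • ((1 - ω 1 • (R 2 * R 3)) * (1 - ω 0 • (R 0 * R 1))) := by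
          rw [hEE, transpose_smul, transpose_mul, transpose_add, transpose_add, transpose_one,
            transpose_smul, transpose_smul, gt 0 (by norm_num) 1 (by norm_num) (by norm_num),
            gt 2 (by norm_num) 3 (by norm_num) (by norm_num)]
          have k1 : ∀ (w : ℂ) (Z : Matrix (Fin (2 * l)) (Fin (2 * l)) ℂ),
              1 + w • -(JJ * Z * JJ) = JJ * (1 - w • Z) * JJ := by
            intro w Z
            rw [Matrix.mul_sub, Matrix.sub_mul, Matrix.mul_one, hJJ]
            simp [sub_eq_add_neg]
          rw [k1, k1, Matrix.mul_smul, Matrix.smul_mul]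
          congr 1
          generalize (1 - ω 1 • (R 2 * R 3)) = A
          generalize (1 - ω 0 • (R 0 * R 1)) = B
          calc JJ * (JJ * A * JJ * (JJ * B * JJ)) * JJ
              = (JJ * JJ) * A * (JJ * JJ) * B * (JJ * JJ) := by noncomm_ring
            _ = A * B := by rw [hJJ]; simp
        rw [e1, hEE, Matrix.mul_smul, Matrix.smul_mul]
        congr 1
        have m0 : T * (1 + ω 0 • (R 0 * R 1)) = (1 - ω 0 • (R 0 * R 1)) * T := by
          rw [Matrix.mul_add, Matrix.mul_smul, c0, Matrix.sub_mul, Matrix.smul_mul]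
          simp [sub_eq_add_neg]
        have m1 : T * (1 + ω 1 • (R 2 * R 3)) = (1 - ω 1 • (R 2 * R 3)) * T := by
          rw [Matrix.mul_add, Matrix.mul_smul, c1, Matrix.sub_mul, Matrix.smul_mul]
          simp [sub_eq_add_neg]
        rw [← Matrix.mul_assoc, m0, Matrix.mul_assoc, m1, ← Matrix.mul_assoc]
        congr 1
        simp only [Matrix.mul_sub, Matrix.sub_mul, Matrix.mul_smul, Matrix.smul_mul, cG,
          Matrix.mul_one, Matrix.one_mul]
        rw [smul_sub, smul_sub, smul_comm (ω 1) (ω 0)]; abel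
      have hXY2 : X * Y = E := hXY
      refine skew_even (Xᵀ * (JJ * T) * X) (Y * (T' * JJ) * Yᵀ) ?_ ?_
      · simp only [transpose_mul, transpose_transpose, hTt, hJt]
        calc Xᵀ * (-(JJ * T * JJ) * JJ * X) = -(Xᵀ * (JJ * T * (JJ * JJ) * X)) := by
              simp only [Matrix.neg_mul, Matrix.mul_neg, Matrix.mul_assoc]
          _ = _ := by rw [hJJ]; simp only [Matrix.mul_one, Matrix.mul_assoc]
      · calc Xᵀ * (JJ * T) * X * (Y * (T' * JJ) * Yᵀ)
            = Xᵀ * (JJ * (T * (X * Y)) * (T' * JJ)) * Yᵀ := by simp only [Matrix.mul_assoc]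
          _ = Xᵀ * (JJ * (JJ * Eᵀ * JJ * T) * (T' * JJ)) * Yᵀ := by rw [hXY2, hTE]
          _ = Xᵀ * ((JJ * JJ) * Eᵀ * (JJ * (T * T') * JJ)) * Yᵀ := by
              simp only [Matrix.mul_assoc]
          _ = Xᵀ * Eᵀ * Yᵀ := by rw [hT, Matrix.mul_one, hJJ]; simp
          _ = (Y * (X * Y) * X)ᵀ := by rw [hXY2]; simp only [transpose_mul, Matrix.mul_assoc]
          _ = ((Y * X) * (Y * X))ᵀ := by simp only [Matrix.mul_assoc]
          _ = 1 := by rw [hYX]; simp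
    norm_num at tr'
    omega
  · -- m ≥ 8
    obtain ⟨t, ht⟩ : ∃ t, m / 2 = t := ⟨_, rfl⟩
    rw [ht] at tr'
    have hd : 1 ≤ d := by
      rcases Nat.eq_zero_or_pos d with h0 | h0
      · rw [h0] at tr'; omega
      · exact h0
    by_cases hm8' : m = 8
    · have : t = 4 := by omega
      subst this
      norm_num at tr'
      omega
    · have ht6 : 6 ≤ t := by omega
      have key : 8 * t < 2 ^ t := by
        clear * - ht6
        induction t, ht6 using Nat.le_induction with
        | base => norm_num
        | succ k hk ih => rw [pow_succ]; omega
      have : 2 ^ t ≤ d * 2 ^ t := Nat.le_mul_of_pos_left _ hd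
      omega

end dims

section retraction
open Filter Topology
variable {n : ℕ} {J : Matrix (Fin n) (Fin n) ℝ} {m : ℕ} {η : ℕ → ℝ}
  {P : ℕ → Matrix (Fin n) (Fin n) ℝ}

lemma bf_continuous {X : Type*} [TopologicalSpace X] {f g : X → Fin n → ℝ}
    (hf : Continuous f) (hg : Continuous g) : Continuous fun x => bf J (f x) (g x) := by
  unfold bf
  exact hf.dotProduct (continuous_const.matrix_mulVec hg)

lemma mv_continuous {X : Type*} [TopologicalSpace X] {f : X → Fin n → ℝ}
    (M : Matrix (Fin n) (Fin n) ℝ) (hf : Continuous f) : Continuous fun x => M *ᵥ f x :=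
  continuous_const.matrix_mulVec hf

lemma pq_continuous : Continuous (pq J m η P) := by
  unfold pq
  refine continuous_finsetSum _ fun j _ => ?_
  exact continuous_const.mul ((bf_continuous (mv_continuous _ continuous_id) continuous_id).pow 2)

lemma nmx_continuous : Continuous fun x => nm J m η P x *ᵥ x := by
  refine Continuous.matrix_mulVec ?_ continuous_id
  unfold nm
  refine continuous_finsetSum _ fun j _ => ?_
  exact (continuous_const.mul (bf_continuous (mv_continuous _ continuous_id)
    continuous_id)).smul continuous_const

/-- coordinate functions are analytic, hence so are the quadratic forms. -/
lemma bf_analytic (A B : Matrix (Fin n) (Fin n) ℝ) (x : Fin n → ℝ) :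
    AnalyticAt ℝ (fun y => bf J (A *ᵥ y) (B *ᵥ y)) x := by
  have hc : ∀ i, AnalyticAt ℝ (fun y : Fin n → ℝ => y i) x := fun i =>
    (ContinuousLinearMap.proj (R := ℝ) (φ := fun _ : Fin n => ℝ) i).analyticAt x
  unfold bf
  simp only [mulVec_mulVec]
  simp only [dotProduct, mulVec]
  refine Finset.analyticAt_fun_sum _ fun i _ => AnalyticAt.fun_mul ?_ ?_
  · exact Finset.analyticAt_fun_sum _ fun k _ => analyticAt_const.fun_mul (hc k)
  · exact Finset.analyticAt_fun_sum _ fun k _ => analyticAt_const.fun_mul (hc k)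

lemma pq_analytic (A : Matrix (Fin n) (Fin n) ℝ) (x : Fin n → ℝ) :
    AnalyticAt ℝ (fun y => pq J m η P (A *ᵥ y)) x := by
  unfold pq
  have := fun j => bf_analytic (J := J) (P j * A) A x
  simp only [← mulVec_mulVec] at this
  fun_prop

lemma analytic_ident {f g : (Fin n → ℝ) → ℝ} (hf : ∀ x, AnalyticAt ℝ f x)
    (hg : ∀ x, AnalyticAt ℝ g x) {x : Fin n → ℝ} (h : f =ᶠ[𝓝 x] g) : ∀ y, f y = g y := by
  have := AnalyticOnNhd.eq_of_eventuallyEq (𝕜 := ℝ) (f := f) (g := g) (z₀ := x)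
    (fun x _ => hf x) (fun x _ => hg x) h
  intro y; rw [this]

/-- coefficient functions of the retraction -/
def rK (J : Matrix (Fin n) (Fin n) ℝ) (m : ℕ) (η : ℕ → ℝ)
    (P : ℕ → Matrix (Fin n) (Fin n) ℝ) (ρ : ℝ) (y : Fin n → ℝ) : ℝ :=
  Real.sqrt (pq J m η P y / ρ)

def rG (J : Matrix (Fin n) (Fin n) ℝ) (m : ℕ) (η : ℕ → ℝ)
    (P : ℕ → Matrix (Fin n) (Fin n) ℝ) (ρ : ℝ) (y : Fin n → ℝ) : ℝ :=
  (rK J m η P ρ y ^ 2 - pq J m η P y) * (bf J y y ^ 2 - pq J m η P y)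

def rT (J : Matrix (Fin n) (Fin n) ℝ) (m : ℕ) (η : ℕ → ℝ)
    (P : ℕ → Matrix (Fin n) (Fin n) ℝ) (ρ : ℝ) (y : Fin n → ℝ) : ℝ :=
  rK J m η P ρ y * bf J y y - pq J m η P y + Real.sqrt (rG J m η P ρ y)

def rE (J : Matrix (Fin n) (Fin n) ℝ) (m : ℕ) (η : ℕ → ℝ)
    (P : ℕ → Matrix (Fin n) (Fin n) ℝ) (ρ : ℝ) (y : Fin n → ℝ) : ℝ :=
  bf J y y - rK J m η P ρ y

def rZ (J : Matrix (Fin n) (Fin n) ℝ) (m : ℕ) (η : ℕ → ℝ)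
    (P : ℕ → Matrix (Fin n) (Fin n) ℝ) (ρ : ℝ) (y : Fin n → ℝ) : Fin n → ℝ :=
  rT J m η P ρ y • y + rE J m η P ρ y • (nm J m η P y *ᵥ y)

lemma rK_cont (ρ : ℝ) : Continuous (rK J m η P ρ) := by
  unfold rK
  exact (pq_continuous.div_const _).sqrt

lemma rG_cont (ρ : ℝ) : Continuous (rG J m η P ρ) := by
  unfold rG
  have h1 := rK_cont (J := J) (m := m) (η := η) (P := P) ρ
  have h2 := pq_continuous (J := J) (m := m) (η := η) (P := P)
  have h3 := bf_continuous (J := J) continuous_id continuous_id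
  exact ((h1.pow 2).sub h2).mul ((h3.pow 2).sub h2)

lemma rZ_cont (ρ : ℝ) : Continuous (rZ J m η P ρ) := by
  unfold rZ rT rE
  have h1 := rK_cont (J := J) (m := m) (η := η) (P := P) ρ
  have h2 := pq_continuous (J := J) (m := m) (η := η) (P := P)
  have h3 := bf_continuous (J := J) continuous_id continuous_id
  have h4 := rG_cont (J := J) (m := m) (η := η) (P := P) ρ
  exact ((((h1.mul h3).sub h2).add h4.sqrt).smul continuous_id).add
    ((h3.sub h1).smul nmx_continuous)

lemma rZ_level (h : CliffData n J m η P) {ρ : ℝ} (hρ : ρ ≠ 0) (y : Fin n → ℝ)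
    (h1 : 0 < pq J m η P y / ρ) (h2 : 0 < rG J m η P ρ y) :
    pq J m η P (rZ J m η P ρ y) = ρ * bf J (rZ J m η P ρ y) (rZ J m η P ρ y) ^ 2 := by
  have hK : rK J m η P ρ y ^ 2 * ρ = pq J m η P y := by
    unfold rK; rw [Real.sq_sqrt h1.le]; field_simp
  have hR : Real.sqrt (rG J m η P ρ y) ^ 2 =
      (rK J m η P ρ y ^ 2 - pq J m η P y) * (bf J y y ^ 2 - pq J m η P y) := by
    rw [Real.sq_sqrt h2.le, rG]
  unfold rZ
  rw [pq_plane h, qq_plane h]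
  unfold rT rE
  set κ := rK J m η P ρ y
  set R := Real.sqrt (rG J m η P ρ y)
  set p := pq J m η P y
  set q := bf J y y
  set a := κ * q - p + R with ha
  set b := q - κ with hb
  have key : a ^ 2 * q + 2 * a * b * p + b ^ 2 * p * q = κ * (a ^ 2 + 2 * a * b * q + p * b ^ 2) := by
    rw [ha, hb]
    linear_combination (q - κ) * hR
  rw [key, ← hK]; ring

lemma rZ_at {ρ : ℝ} (hρ : ρ ≠ 0) (hρ1 : ρ < 1) {x : Fin n → ℝ}
    (hq : bf J x x = 1) (hp : pq J m η P x = ρ) :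
    rK J m η P ρ x = 1 ∧ rG J m η P ρ x = (1 - ρ) ^ 2 ∧ rT J m η P ρ x = 2 * (1 - ρ) ∧
    rE J m η P ρ x = 0 ∧ rZ J m η P ρ x = (2 * (1 - ρ)) • x := by
  have e1 : rK J m η P ρ x = 1 := by unfold rK; rw [hp, div_self hρ, Real.sqrt_one]
  have e2 : rG J m η P ρ x = (1 - ρ) ^ 2 := by unfold rG; rw [e1, hp, hq]; ring
  have e3 : rT J m η P ρ x = 2 * (1 - ρ) := by
    unfold rT; rw [e2, e1, hp, hq, Real.sqrt_sq (by linarith)]; ring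
  have e4 : rE J m η P ρ x = 0 := by unfold rE; rw [e1, hq]; ring
  refine ⟨e1, e2, e3, e4, ?_⟩
  unfold rZ; rw [e3, e4, zero_smul, add_zero]

lemma ret_nbhd (h : CliffData n J m η P) {ρ : ℝ} (hρ : ρ ≠ 0) (hρ1 : ρ < 1)
    {M : Set (Fin n → ℝ)} (hM : ∀ x, x ∈ M ↔ bf J x x = 1 ∧ pq J m η P x = ρ)
    {x₀ x : Fin n → ℝ} (hx : x ∈ connectedComponentIn M x₀) :
    ∀ᶠ y in 𝓝 x, ∃ t : ℝ, t ^ 2 * bf J (rZ J m η P ρ y) (rZ J m η P ρ y) = 1 ∧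
      t • rZ J m η P ρ y ∈ connectedComponentIn M x₀ := by
  obtain ⟨hq, hp⟩ := (hM x).1 (connectedComponentIn_subset M x₀ hx)
  obtain ⟨e1, e2, e3, e4, e5⟩ := rZ_at hρ hρ1 hq hp
  have hZc := rZ_cont (J := J) (m := m) (η := η) (P := P) ρ
  have hqc : Continuous fun y => bf J (rZ J m η P ρ y) (rZ J m η P ρ y) :=
    bf_continuous hZc hZc
  have hqx : bf J (rZ J m η P ρ x) (rZ J m η P ρ x) = (2 * (1 - ρ)) ^ 2 := by
    rw [e5, bf_smul_left, bf_smul_right, hq]; ring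
  have n1 : ∀ᶠ y in 𝓝 x, 0 < pq J m η P y / ρ := by
    apply ((pq_continuous.div_const ρ).continuousAt (x := x)).eventually_const_lt
    beta_reduce
    rw [hp, div_self hρ]; norm_num
  have n2 : ∀ᶠ y in 𝓝 x, 0 < rG J m η P ρ y := by
    apply ((rG_cont ρ).continuousAt (x := x)).eventually_const_lt
    rw [e2]; have : 0 < 1 - ρ := by linarith
    positivity
  have n3 : ∀ᶠ y in 𝓝 x, 0 < bf J (rZ J m η P ρ y) (rZ J m η P ρ y) := by
    apply (hqc.continuousAt (x := x)).eventually_const_lt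
    beta_reduce
    rw [hqx]; have : 0 < 1 - ρ := by linarith
    positivity
  obtain ⟨ε, hε, hball⟩ := Metric.eventually_nhds_iff_ball.1 (n1.and (n2.and n3))
  let π : (Fin n → ℝ) → (Fin n → ℝ) := fun y =>
    (Real.sqrt (bf J (rZ J m η P ρ y) (rZ J m η P ρ y)))⁻¹ • rZ J m η P ρ y
  have hπt : ∀ y ∈ Metric.ball x ε,
      (Real.sqrt (bf J (rZ J m η P ρ y) (rZ J m η P ρ y)))⁻¹ ^ 2 *
        bf J (rZ J m η P ρ y) (rZ J m η P ρ y) = 1 := by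
    intro y hy
    obtain ⟨_, _, h3⟩ := hball y hy
    rw [inv_pow, Real.sq_sqrt h3.le, inv_mul_cancel₀ h3.ne']
  have hπM : ∀ y ∈ Metric.ball x ε, π y ∈ M := by
    intro y hy
    obtain ⟨h1, h2, h3⟩ := hball y hy
    have ht := hπt y hy
    rw [hM]
    simp only [π]
    rw [bf_smul_left, bf_smul_right, pq_smul, rZ_level h hρ y h1 h2]
    generalize (Real.sqrt (bf J (rZ J m η P ρ y) (rZ J m η P ρ y)))⁻¹ = t at *
    generalize bf J (rZ J m η P ρ y) (rZ J m η P ρ y) = w at *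
    constructor
    · linear_combination ht
    · linear_combination ρ * (t ^ 2 * w + 1) * ht
  have hπx : π x = x := by
    simp only [π]; rw [hqx, Real.sqrt_sq (by linarith), e5, smul_smul, inv_mul_cancel₀, one_smul]
    intro h0; linarith
  have hπc : ContinuousOn π (Metric.ball x ε) := by
    refine ContinuousOn.smul (ContinuousOn.inv₀ hqc.sqrt.continuousOn ?_) hZc.continuousOn
    intro y hy
    exact (Real.sqrt_pos.2 (hball y hy).2.2).ne'
  have hpre : IsPreconnected (π '' Metric.ball x ε) :=
    ((convex_ball x ε).isPreconnected).image π hπc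
  have hxb : x ∈ Metric.ball x ε := Metric.mem_ball_self hε
  have hsub : π '' Metric.ball x ε ⊆ connectedComponentIn M x₀ := by
    rw [connectedComponentIn_eq hx]
    refine hpre.subset_connectedComponentIn ⟨x, hxb, hπx⟩ ?_
    rintro _ ⟨y, hy, rfl⟩; exact hπM y hy
  filter_upwards [Metric.ball_mem_nhds x hε] with y hy
  exact ⟨_, hπt y hy, hsub ⟨y, hy, rfl⟩⟩

end retraction

section gradient
open Filter Topology
variable {n : ℕ} {J : Matrix (Fin n) (Fin n) ℝ} {m : ℕ} {η : ℕ → ℝ}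
  {P : ℕ → Matrix (Fin n) (Fin n) ℝ}

lemma mv_deriv (M : Matrix (Fin n) (Fin n) ℝ) {f : ℝ → Fin n → ℝ} {f' : Fin n → ℝ} {t : ℝ}
    (hf : HasDerivAt f f' t) : HasDerivAt (fun s => M *ᵥ f s) (M *ᵥ f') t := by
  rw [hasDerivAt_pi] at hf ⊢
  intro i
  simp only [mulVec, dotProduct]
  exact HasDerivAt.fun_sum fun k _ => (hf k).const_mul _

lemma bf_deriv {f g : ℝ → Fin n → ℝ} {f' g' : Fin n → ℝ} {t : ℝ}
    (hf : HasDerivAt f f' t) (hg : HasDerivAt g g' t) :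
    HasDerivAt (fun s => bf J (f s) (g s)) (bf J f' (g t) + bf J (f t) g') t := by
  have h2 := mv_deriv J hg
  rw [hasDerivAt_pi] at hf h2
  simp only [bf, dotProduct]
  rw [← Finset.sum_add_distrib]
  exact HasDerivAt.fun_sum fun k _ => (hf k).mul (h2 k)

lemma pq_deriv (h : CliffData n J m η P) {f : ℝ → Fin n → ℝ} {f' : Fin n → ℝ} {t : ℝ}
    (hf : HasDerivAt f f' t) :
    HasDerivAt (fun s => pq J m η P (f s)) (4 * bf J (nm J m η P (f t) *ᵥ f t) f') t := by
  have e : 4 * bf J (nm J m η P (f t) *ᵥ f t) f' = ∑ j ∈ Finset.range m,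
      η j * (2 * bf J (P j *ᵥ f t) (f t) ^ (2 - 1) *
        (bf J (P j *ᵥ f') (f t) + bf J (P j *ᵥ f t) f')) := by
    unfold nm
    rw [sum_mulVec, bf_sum_left, Finset.mul_sum]
    refine Finset.sum_congr rfl fun j hj => ?_
    rw [smul_mulVec, bf_smul_left, bf_adj h.JJ (h.sym j (Finset.mem_range.1 hj)) f',
      bf_comm h.Jt f']
    ring
  rw [e]
  unfold pq
  refine HasDerivAt.fun_sum fun j _ => ?_
  have := ((bf_deriv (J := J) (mv_deriv (P j) hf) hf).fun_pow 2).const_mul (η j)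
  exact_mod_cast this

lemma nmx_deriv {f : ℝ → Fin n → ℝ} {f' : Fin n → ℝ} {t : ℝ}
    (hf : HasDerivAt f f' t) :
    ∃ w, HasDerivAt (fun s => nm J m η P (f s) *ᵥ f s) w t := by
  refine ⟨∑ j ∈ Finset.range m, ((η j * bf J (P j *ᵥ f t) (f t)) • (P j *ᵥ f') +
    (η j * (bf J (P j *ᵥ f') (f t) + bf J (P j *ᵥ f t) f')) • (P j *ᵥ f t)), ?_⟩
  have e : (fun s => nm J m η P (f s) *ᵥ f s) = fun s => ∑ j ∈ Finset.range m,
      (η j * bf J (P j *ᵥ f s) (f s)) • (P j *ᵥ f s) := by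
    funext s
    unfold nm
    rw [sum_mulVec]
    exact Finset.sum_congr rfl fun j hj => by rw [smul_mulVec]
  rw [e]
  refine HasDerivAt.fun_sum fun j _ => ?_
  exact ((bf_deriv (J := J) (mv_deriv (P j) hf) hf).const_mul (η j)).fun_smul (mv_deriv (P j) hf)

lemma rZ_deriv (h : CliffData n J m η P) {ρ : ℝ} (hρ : ρ ≠ 0) (hρ1 : ρ < 1) {x v : Fin n → ℝ}
    (hq : bf J x x = 1) (hp : pq J m η P x = ρ) (hv : bf J x v = 0)
    (hNv : bf J (nm J m η P x *ᵥ x) v = 0) :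
    HasDerivAt (fun t : ℝ => rZ J m η P ρ (x + t • v)) ((2 * (1 - ρ)) • v) 0 := by
  obtain ⟨e1, e2, e3, e4, e5⟩ := rZ_at hρ hρ1 hq hp
  have x0 : x + (0:ℝ) • v = x := by simp
  have hl : HasDerivAt (fun t : ℝ => x + t • v) v 0 := by
    have := ((hasDerivAt_id (0:ℝ)).smul_const v).const_add x
    simpa using this
  have dq : HasDerivAt (fun t : ℝ => bf J (x + t • v) (x + t • v)) 0 0 := by
    have := bf_deriv (J := J) hl hl
    rw [x0, bf_comm h.Jt v x, hv, add_zero] at this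
    exact this
  have dp : HasDerivAt (fun t : ℝ => pq J m η P (x + t • v)) 0 0 := by
    have := pq_deriv h hl
    rw [x0, hNv, mul_zero] at this
    exact this
  have dK : HasDerivAt (fun t : ℝ => rK J m η P ρ (x + t • v)) 0 0 := by
    unfold rK
    have := (dp.div_const ρ).sqrt (by rw [x0, hp, div_self hρ]; norm_num)
    simpa using this
  have dG : HasDerivAt (fun t : ℝ => rG J m η P ρ (x + t • v)) 0 0 := by
    unfold rG
    have := ((dK.fun_pow 2).fun_sub dp).fun_mul ((dq.fun_pow 2).fun_sub dp)
    simpa using this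
  have dT : HasDerivAt (fun t : ℝ => rT J m η P ρ (x + t • v)) 0 0 := by
    unfold rT
    have := ((dK.fun_mul dq).fun_sub dp).fun_add (dG.sqrt (by
      rw [x0, e2]; have : 0 < 1 - ρ := by linarith
      positivity))
    simpa using this
  have dE : HasDerivAt (fun t : ℝ => rE J m η P ρ (x + t • v)) 0 0 := by
    unfold rE
    have := dq.fun_sub dK
    simpa using this
  obtain ⟨w, hw⟩ := nmx_deriv (J := J) (m := m) (η := η) (P := P) hl
  unfold rZ
  have := (dT.fun_smul hl).fun_add (dE.fun_smul hw)
  simp only [e3, e4, zero_smul, add_zero] at this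
  exact this

/-- the differential kills the tangent vectors. -/
lemma grad_zero (h : CliffData n J m η P) {ρ : ℝ} (hρ : ρ ≠ 0) (hρ1 : ρ < 1)
    {M : Set (Fin n → ℝ)} (hM : ∀ x, x ∈ M ↔ bf J x x = 1 ∧ pq J m η P x = ρ)
    {x₀ : Fin n → ℝ} {A : Matrix (Fin n) (Fin n) ℝ}
    (hA : ∀ x ∈ connectedComponentIn M x₀, pq J m η P (A *ᵥ x) = ρ)
    {x v : Fin n → ℝ} (hx : x ∈ connectedComponentIn M x₀) (hv : bf J x v = 0)
    (hNv : bf J (nm J m η P x *ᵥ x) v = 0) :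
    bf J (nm J m η P (A *ᵥ x) *ᵥ (A *ᵥ x)) (A *ᵥ v) = 0 := by
  obtain ⟨hq, hp⟩ := (hM x).1 (connectedComponentIn_subset M x₀ hx)
  obtain ⟨e1, e2, e3, e4, e5⟩ := rZ_at hρ hρ1 hq hp
  have x0 : x + (0:ℝ) • v = x := by simp
  have hd := rZ_deriv h hρ hρ1 hq hp hv hNv
  have hcont : Tendsto (fun t : ℝ => x + t • v) (𝓝 0) (𝓝 x) := by
    have : Continuous fun t : ℝ => x + t • v := by fun_prop
    have := this.tendsto 0
    rwa [x0] at this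
  have hev : ∀ᶠ t : ℝ in 𝓝 0, pq J m η P (A *ᵥ rZ J m η P ρ (x + t • v)) -
      ρ * bf J (rZ J m η P ρ (x + t • v)) (rZ J m η P ρ (x + t • v)) ^ 2 = 0 := by
    filter_upwards [hcont.eventually (ret_nbhd h hρ hρ1 hM hx)] with t ht
    obtain ⟨s, hs, hsL⟩ := ht
    have := hA _ hsL
    rw [mulVec_smul, pq_smul] at this
    generalize rZ J m η P ρ (x + t • v) = z at *
    have hs0 : s ^ 4 ≠ 0 := by
      intro h0
      have : s = 0 := by simpa using h0
      rw [this] at hs; norm_num at hs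
    have : s ^ 4 * (pq J m η P (A *ᵥ z) - ρ * bf J z z ^ 2) = 0 := by
      linear_combination this - ρ * (s ^ 2 * bf J z z + 1) * hs
    exact (mul_eq_zero.1 this).resolve_left hs0
  have d1 := (pq_deriv h (mv_deriv A hd)).fun_sub (((bf_deriv (J := J) hd hd).fun_pow 2).const_mul ρ)
  have d0 : HasDerivAt (fun t : ℝ => pq J m η P (A *ᵥ rZ J m η P ρ (x + t • v)) -
      ρ * bf J (rZ J m η P ρ (x + t • v)) (rZ J m η P ρ (x + t • v)) ^ 2) 0 0 :=
    (hasDerivAt_const (0:ℝ) (0:ℝ)).congr_of_eventuallyEq hev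
  have := d1.unique d0
  simp only [x0, e5, bf_smul_left, bf_smul_right, bf_comm h.Jt v x, hv, mul_zero, add_zero,
    sub_zero, mulVec_smul] at this
  have hpl : nm J m η P ((2 * (1 - ρ)) • A *ᵥ x) = (2 * (1 - ρ)) ^ 2 • nm J m η P (A *ᵥ x) := by
    have := nm_plane h (A *ᵥ x) (2 * (1 - ρ)) 0
    simpa using this
  rw [hpl, smul_mulVec, bf_smul_left] at this
  have hne : (2 * (1 - ρ)) ≠ 0 := by intro h0; linarith
  simpa [hne, sub_ne_zero.2 hρ1.ne'] using this

end gradient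

section final
open Filter Topology
variable {n : ℕ} {J : Matrix (Fin n) (Fin n) ℝ} {m : ℕ} {η : ℕ → ℝ}
  {P : ℕ → Matrix (Fin n) (Fin n) ℝ}

lemma bf_orth {A : Matrix (Fin n) (Fin n) ℝ} (hO : Aᵀ * J * A = J) (x y : Fin n → ℝ) :
    bf J (A *ᵥ x) (A *ᵥ y) = bf J x y := by
  unfold bf
  conv_rhs => rw [← hO]
  rw [← mulVec_mulVec, ← mulVec_mulVec, mulVec_transpose, dotProduct_comm x, ← dotProduct_mulVec,
    dotProduct_comm]

/-- the mixed product which detects the sign -/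
def gam (J : Matrix (Fin n) (Fin n) ℝ) (m : ℕ) (η : ℕ → ℝ)
    (P : ℕ → Matrix (Fin n) (Fin n) ℝ) (A : Matrix (Fin n) (Fin n) ℝ) (x : Fin n → ℝ) : ℝ :=
  bf J (nm J m η P (A *ᵥ x) *ᵥ (A *ᵥ x)) (A *ᵥ (nm J m η P x *ᵥ x))

lemma gam_cont (A : Matrix (Fin n) (Fin n) ℝ) : Continuous (gam J m η P A) := by
  unfold gam
  refine bf_continuous ?_ (mv_continuous _ nmx_continuous)
  exact (nmx_continuous (J := J) (m := m) (η := η) (P := P)).comp (mv_continuous A continuous_id)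

lemma normal_form (h : CliffData n J m η P) {ρ : ℝ} (hρ : ρ ≠ 0) (hρ1 : ρ < 1)
    {M : Set (Fin n → ℝ)} (hM : ∀ x, x ∈ M ↔ bf J x x = 1 ∧ pq J m η P x = ρ)
    {x₀ : Fin n → ℝ} {A A' : Matrix (Fin n) (Fin n) ℝ} (hAA : A * A' = 1)
    (hO : Aᵀ * J * A = J)
    (hA : ∀ x ∈ connectedComponentIn M x₀, pq J m η P (A *ᵥ x) = ρ)
    {x : Fin n → ℝ} (hx : x ∈ connectedComponentIn M x₀) {β : ℝ}
    (hβ : β = (gam J m η P A x - ρ ^ 2) / (ρ - ρ ^ 2)) :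
    β ^ 2 = 1 ∧ nm J m η P (A *ᵥ x) *ᵥ (A *ᵥ x) =
      (ρ * (1 - β)) • (A *ᵥ x) + β • (A *ᵥ (nm J m η P x *ᵥ x)) := by
  obtain ⟨hq, hp⟩ := (hM x).1 (connectedComponentIn_subset M x₀ hx)
  have hpA := hA x hx
  have hne : ρ - ρ ^ 2 ≠ 0 := by
    have : ρ * (1 - ρ) ≠ 0 := mul_ne_zero hρ (by linarith)
    intro h0; apply this; linarith
  have hγ : gam J m η P A x = ρ ^ 2 * (1 - β) + β * ρ := by
    have : β * (ρ - ρ ^ 2) = gam J m η P A x - ρ ^ 2 := by rw [hβ, div_mul_cancel₀ _ hne]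
    linear_combination -this
  unfold gam at hγ
  have hg := fun (v : Fin n → ℝ) h1 h2 => grad_zero h hρ hρ1 hM hA hx (v := v) h1 h2
  have hqA : bf J (A *ᵥ x) (A *ᵥ x) = 1 := by rw [bf_orth hO, hq]
  have hnA := bf_nm_self (J := J) (m := m) (η := η) (P := P) (A *ᵥ x)
  have hnn := bf_nm_nm h (A *ᵥ x)
  rw [hpA] at hnA
  rw [hpA, hqA, mul_one] at hnn
  have hNx := bf_nm_self (J := J) (m := m) (η := η) (P := P) x
  rw [hp] at hNx
  have hNN := bf_nm_nm h x
  rw [hp, hq, mul_one] at hNN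
  set N := nm J m η P x *ᵥ x
  set N' := nm J m η P (A *ᵥ x) *ᵥ (A *ᵥ x)
  have hxN : bf J x N = ρ := by rw [bf_comm h.Jt, hNx]
  have hu : N' - ((ρ * (1 - β)) • (A *ᵥ x) + β • (A *ᵥ N)) = 0 := by
    apply bf_nondeg h.JJ
    intro y
    obtain ⟨w, rfl⟩ : ∃ w, y = A *ᵥ w := ⟨A' *ᵥ y, by rw [mulVec_mulVec, hAA, one_mulVec]⟩
    -- decompose w
    let b := (bf J N w - ρ * bf J x w) / (ρ - ρ ^ 2)
    let a := bf J x w - b * ρ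
    have hb : b * (ρ - ρ ^ 2) = bf J N w - ρ * bf J x w := by
      simp only [b]; exact div_mul_cancel₀ _ hne
    have ha : a = bf J x w - b * ρ := rfl
    have v1 : bf J x (w - a • x - b • N) = 0 := by
      rw [bf_sub_right, bf_sub_right, bf_smul_right, bf_smul_right, hq, hxN, ha]; ring
    have v2 : bf J N (w - a • x - b • N) = 0 := by
      rw [bf_sub_right, bf_sub_right, bf_smul_right, bf_smul_right, hNx, hNN, ha]
      linear_combination -hb
    have v3 := hg _ v1 v2
    have hw : w = (w - a • x - b • N) + a • x + b • N := by abel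
    generalize w - a • x - b • N = v at v1 v2 v3 hw
    rw [hw]
    simp only [mulVec_add, mulVec_smul, bf_add_right, bf_smul_right, bf_sub_left, bf_add_left,
      bf_smul_left, bf_orth hO, v1, v2, v3, hγ, hnA, hq, hxN, hNx, hNN]
    ring
  have hN' := sub_eq_zero.1 hu
  refine ⟨?_, hN'⟩
  rw [hN'] at hnn
  simp only [bf_add_right, bf_smul_right, bf_add_left,
      bf_smul_left, bf_orth hO, hq, hxN, hNx, hNN] at hnn
  have : (β ^ 2 - 1) * (ρ - ρ ^ 2) = 0 := by linear_combination hnn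
  have := (mul_eq_zero.1 this).resolve_right hne
  linarith

lemma pq_plane_A (h : CliffData n J m η P) {ρ : ℝ}
    {A : Matrix (Fin n) (Fin n) ℝ} {x : Fin n → ℝ} {β : ℝ} (hβ : β ^ 2 = 1)
    (hq : bf J (A *ᵥ x) (A *ᵥ x) = 1) (hp : pq J m η P (A *ᵥ x) = ρ)
    (hN : nm J m η P (A *ᵥ x) *ᵥ (A *ᵥ x) =
      (ρ * (1 - β)) • (A *ᵥ x) + β • (A *ᵥ (nm J m η P x *ᵥ x))) (a b : ℝ) :
    pq J m η P (A *ᵥ (a • x + b • (nm J m η P x *ᵥ x))) =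
    ((a - b * β * (ρ * (1 - β))) ^ 2 + 2 * (a - b * β * (ρ * (1 - β))) * (b * β) +
      ρ * (b * β) ^ 2) ^ 2 * ρ := by
  have e : A *ᵥ (a • x + b • (nm J m η P x *ᵥ x)) =
      (a - b * β * (ρ * (1 - β))) • (A *ᵥ x) +
        (b * β) • (nm J m η P (A *ᵥ x) *ᵥ (A *ᵥ x)) := by
    rw [hN, mulVec_add, mulVec_smul, mulVec_smul, smul_add, smul_smul, smul_smul,
      show b * β * β = b by linear_combination b * hβ, ← add_assoc, ← add_smul]
    congr 2; ring
  rw [e, pq_plane h, hp, hq]; ring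

lemma plane_inv (h : CliffData n J m η P) {ρ : ℝ} (hρ : ρ ≠ 0) (hρ1 : ρ < 1)
    {y z : Fin n → ℝ} {a b : ℝ} (hz : z = a • y + b • (nm J m η P y *ᵥ y))
    (hq : bf J z z = 1) (hp : pq J m η P z = ρ) :
    (bf J y y ^ 2 - pq J m η P y) * (a ^ 2 - b ^ 2 * pq J m η P y) ^ 2 = 1 - ρ ∧
    ∃ a1 b1 : ℝ, y = a1 • z + b1 • (nm J m η P z *ᵥ z) := by
  have e1 : (bf J y y ^ 2 - pq J m η P y) * (a ^ 2 - b ^ 2 * pq J m η P y) ^ 2 = 1 - ρ := by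
    rw [hz, qq_plane h] at hq
    rw [hz, pq_plane h] at hp
    generalize pq J m η P y = p at *
    generalize bf J y y = q at *
    rw [← hp]
    linear_combination (a ^ 2 * q + 2 * a * b * p + b ^ 2 * p * q + 1) * hq
  refine ⟨e1, ?_⟩
  have d0 : a ^ 2 - b ^ 2 * pq J m η P y ≠ 0 := by
    intro h0; rw [h0] at e1; norm_num at e1; linarith
  set S := a ^ 2 + 2 * a * b * bf J y y + pq J m η P y * b ^ 2 with hS
  have hS0 : S ≠ 0 := by
    intro h0
    rw [hz, pq_plane h, ← hS, h0] at hp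
    apply hρ; rw [← hp]; ring
  have hNz : nm J m η P z *ᵥ z = (S * b * pq J m η P y) • y + (S * a) • (nm J m η P y *ᵥ y) := by
    rw [hz, nm_plane h, ← hS, smul_mulVec, mulVec_add, mulVec_smul, mulVec_smul, mulVec_mulVec,
      nm_sq h, smul_mulVec, one_mulVec]
    module
  refine ⟨a / (a ^ 2 - b ^ 2 * pq J m η P y), -b / (S * (a ^ 2 - b ^ 2 * pq J m η P y)), ?_⟩
  rw [hNz]
  conv_rhs => rw [hz]
  set p := pq J m η P y
  set D := a ^ 2 - b ^ 2 * p with hD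
  have c1 : a / D * a + -b / (S * D) * (S * b * p) = 1 := by
    field_simp; rw [hD]; ring
  have c2 : a / D * b + -b / (S * D) * (S * a) = 0 := by
    field_simp; ring
  have : (a / D) • (a • y + b • (nm J m η P y *ᵥ y)) + (-b / (S * D)) • ((S * b * p) • y +
      (S * a) • (nm J m η P y *ᵥ y)) = (a / D * a + -b / (S * D) * (S * b * p)) • y +
      (a / D * b + -b / (S * D) * (S * a)) • (nm J m η P y *ᵥ y) := by module
  rw [this, c1, c2, one_smul, zero_smul, add_zero]

/-- a continuous function with values in a two-element set is constant on a preconnected set -/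
lemma two_valued {L : Set (Fin n → ℝ)} (hL : IsPreconnected L) {f : (Fin n → ℝ) → ℝ}
    (hf : Continuous f) {S : Set ℝ} (hS : S.Finite) (hv : ∀ x ∈ L, f x ∈ S) {x y : Fin n → ℝ}
    (hx : x ∈ L) (hy : y ∈ L) : f x = f y := by
  have h1 := hL.image f hf.continuousOn
  by_contra hne
  have h2 : (f '' L).Nontrivial := ⟨f x, ⟨x, hx, rfl⟩, f y, ⟨y, hy, rfl⟩, hne⟩
  have h3 := h1.infinite_of_nontrivial h2
  apply h3
  exact hS.subset (by rintro _ ⟨z, hz, rfl⟩; exact hv z hz)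

lemma same_sign (h : CliffData n J m η P) {ρ : ℝ} (hρ : ρ ≠ 0) (hρ1 : ρ < 1)
    {M : Set (Fin n → ℝ)} (hM : ∀ x, x ∈ M ↔ bf J x x = 1 ∧ pq J m η P x = ρ)
    {x₀ : Fin n → ℝ} (hx₀ : x₀ ∈ connectedComponentIn M x₀)
    {A A' B B' : Matrix (Fin n) (Fin n) ℝ} (hAA : A * A' = 1) (hBB : B * B' = 1)
    (hOA : Aᵀ * J * A = J) (hOB : Bᵀ * J * B = J)
    (hA : ∀ x ∈ connectedComponentIn M x₀, pq J m η P (A *ᵥ x) = ρ)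
    (hB : ∀ x ∈ connectedComponentIn M x₀, pq J m η P (B *ᵥ x) = ρ)
    (hg : gam J m η P A x₀ = gam J m η P B x₀) :
    ∀ y, pq J m η P (A *ᵥ y) = pq J m η P (B *ᵥ y) := by
  have hne : ρ - ρ ^ 2 ≠ 0 := by
    have : ρ * (1 - ρ) ≠ 0 := mul_ne_zero hρ (by linarith)
    intro h0; apply this; linarith
  have hcon : ∀ {C C' : Matrix (Fin n) (Fin n) ℝ}, C * C' = 1 → Cᵀ * J * C = J →
      (∀ x ∈ connectedComponentIn M x₀, pq J m η P (C *ᵥ x) = ρ) →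
      ∀ x ∈ connectedComponentIn M x₀, gam J m η P C x = gam J m η P C x₀ := by
    intro C C' h1 h2 h3 x hx
    refine two_valued isPreconnected_connectedComponentIn (gam_cont C)
      (S := {ρ, 2 * ρ ^ 2 - ρ}) (by simp) ?_ hx hx₀
    intro z hz
    obtain ⟨e, -⟩ := normal_form h hρ hρ1 hM h1 h2 h3 hz rfl
    rcases mul_self_eq_one_iff.1 ((pow_two _).symm.trans e) with e | e <;> rw [div_eq_iff hne] at e
    · left; linarith
    · right; simp only [Set.mem_singleton_iff]; linarith
  refine analytic_ident (pq_analytic A) (pq_analytic B) (x := x₀) ?_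
  filter_upwards [ret_nbhd h hρ hρ1 hM hx₀] with y hy
  obtain ⟨t, -, htL⟩ := hy
  have hz : t • rZ J m η P ρ y = (t * rT J m η P ρ y) • y +
      (t * rE J m η P ρ y) • (nm J m η P y *ᵥ y) := by
    unfold rZ; module
  generalize t • rZ J m η P ρ y = z at *
  obtain ⟨hq, hp⟩ := (hM z).1 (connectedComponentIn_subset M x₀ htL)
  obtain ⟨-, a, b, hy⟩ := plane_inv h hρ hρ1 hz hq hp
  obtain ⟨sA, nA⟩ := normal_form h hρ hρ1 hM hAA hOA hA htL rfl
  obtain ⟨sB, nB⟩ := normal_form h hρ hρ1 hM hBB hOB hB htL rfl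
  have fA := pq_plane_A h sA (by rw [bf_orth hOA, hq]) (hA z htL) nA a b
  have fB := pq_plane_A h sB (by rw [bf_orth hOB, hq]) (hB z htL) nB a b
  rw [← hy] at fA fB
  rw [fA, fB, hcon hAA hOA hA z htL, hcon hBB hOB hB z htL, hg]

end final

section core
open Filter Topology
variable {n : ℕ} {J : Matrix (Fin n) (Fin n) ℝ} {m : ℕ} {η : ℕ → ℝ}
  {P : ℕ → Matrix (Fin n) (Fin n) ℝ}

lemma anti_zero (h : CliffData n J m η P) {Q : Matrix (Fin n) (Fin n) ℝ} (hQs : Qᵀ = J * Q * J)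
    (hQP : ∀ j < m, P j * Q = - (Q * P j)) {u w : Fin n → ℝ} {ε : ℝ} (hε : ε ^ 2 = 1)
    (hu : Q *ᵥ u = ε • u) (hw : Q *ᵥ w = ε • w) {j : ℕ} (hj : j < m) :
    bf J (P j *ᵥ u) w = 0 := by
  have e1 : bf J (P j *ᵥ (Q *ᵥ u)) w = - bf J (P j *ᵥ u) (Q *ᵥ w) := by
    rw [← bf_adj h.JJ hQs, mulVec_mulVec, hQP j hj, neg_mulVec, bf_neg_left, mulVec_mulVec]
  rw [hu, hw, mulVec_smul, bf_smul_left, bf_smul_right] at e1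
  linear_combination (ε / 2) * e1 - bf J (P j *ᵥ u) w * hε

lemma trace_contra {l : ℕ} {J : Matrix (Fin (2 * l)) (Fin (2 * l)) ℝ}
    {P : ℕ → Matrix (Fin (2 * l)) (Fin (2 * l)) ℝ}
    (h : CliffData (2 * l) J m η P) (hm0 : 0 < m) {Q : Matrix (Fin (2 * l)) (Fin (2 * l)) ℝ}
    (hQs : Qᵀ = J * Q * J) (hQP : ∀ j < m, P j * Q = - (Q * P j))
    {u : Fin (2 * l) → ℝ} (hu : bf J u u ≠ 0)
    (hw : ∀ w, ∑ j ∈ Finset.range m, η j * bf J (P j *ᵥ u) w ^ 2 =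
      bf J u u * ((bf J w w - bf J (Q *ᵥ w) w) / 2)) : m = l := by
  have hJQ : (J * Q)ᵀ = J * Q := by
    rw [transpose_mul, hQs, h.Jt, Matrix.mul_assoc, h.JJ, Matrix.mul_one]
  have key : ∑ j ∈ Finset.range m, η j • vecMulVec (J *ᵥ (P j *ᵥ u)) (J *ᵥ (P j *ᵥ u)) =
      (bf J u u / 2) • (J - J * Q) := by
    apply sym_ext
    · rw [transpose_sum]
      refine Finset.sum_congr rfl fun j _ => ?_
      rw [transpose_smul, transpose_vecMulVec]
    · rw [transpose_smul, transpose_sub, h.Jt, hJQ]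
    · intro w
      have e1 : w ⬝ᵥ ((∑ j ∈ Finset.range m, η j • vecMulVec (J *ᵥ (P j *ᵥ u)) (J *ᵥ (P j *ᵥ u)))
          *ᵥ w) = ∑ j ∈ Finset.range m, η j * bf J (P j *ᵥ u) w ^ 2 := by
        rw [sum_mulVec, dotProduct_sum]
        refine Finset.sum_congr rfl fun j _ => ?_
        rw [smul_mulVec, dotProduct_smul, vecMulVec_mulVec, bf_comm h.Jt, bf, smul_eq_mul]
        simp only [op_smul_eq_smul, dotProduct_smul, smul_eq_mul]
        rw [dotProduct_comm (J *ᵥ (P j *ᵥ u)) w]; ring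
      have e2 : bf J (Q *ᵥ w) w = w ⬝ᵥ ((J * Q) *ᵥ w) := by
        rw [bf_comm h.Jt, bf, mulVec_mulVec]
      rw [e1, hw, smul_mulVec, dotProduct_smul, sub_mulVec, dotProduct_sub, ← e2, smul_eq_mul]
      unfold bf; ring
  have t := congrArg (fun X => trace (J * X)) key
  simp only [Matrix.mul_sum, trace_sum, Matrix.mul_smul, trace_smul, Matrix.mul_sub, h.JJ,
    ← Matrix.mul_assoc, Matrix.one_mul, trace_sub, trace_one, Fintype.card_fin, smul_eq_mul,
    trace_anti h hm0 (hQP 0 hm0)] at t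
  have e3 : ∀ j ∈ Finset.range m, η j * trace (J * vecMulVec (J *ᵥ (P j *ᵥ u)) (J *ᵥ (P j *ᵥ u))) =
      bf J u u := by
    intro j hj
    have hj' := Finset.mem_range.1 hj
    rw [mul_vecMulVec, mulVec_mulVec, h.JJ, one_mulVec, trace_vecMulVec]
    have : (P j *ᵥ u) ⬝ᵥ (J *ᵥ (P j *ᵥ u)) = bf J (P j *ᵥ u) (P j *ᵥ u) := rfl
    rw [this, ← bf_adj h.JJ (h.sym j hj'), mulVec_mulVec, h.sq j hj', smul_mulVec, one_mulVec,
      bf_smul_left, ← mul_assoc, h.ηsq, one_mul]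
  rw [Finset.sum_congr rfl e3] at t
  simp only [Finset.sum_const, Finset.card_range, nsmul_eq_mul] at t
  have : (m : ℝ) = l := by
    apply mul_right_cancel₀ hu
    rw [t]; push_cast; ring
  exact_mod_cast this

theorem core_contra {l : ℕ} {J : Matrix (Fin (2 * l)) (Fin (2 * l)) ℝ}
    {P : ℕ → Matrix (Fin (2 * l)) (Fin (2 * l)) ℝ}
    (h : CliffData (2 * l) J m η P) (hm : 2 ≤ m) (hm4 : m % 4 = 0) (hlm : m < l)
    (hη : ∏ j ∈ Finset.range m, η j = 1)
    {ρ : ℝ} (hρ : ρ ≠ 0) (hρ1 : ρ < 1)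
    {M : Set (Fin (2 * l) → ℝ)} (hM : ∀ x, x ∈ M ↔ bf J x x = 1 ∧ pq J m η P x = ρ)
    {x₀ : Fin (2 * l) → ℝ} (hx₀M : x₀ ∈ M) (K : Set (Matrix (Fin (2 * l)) (Fin (2 * l)) ℝ))
    (hO : ∀ A ∈ K, Aᵀ * J * A = J)
    (hmul : ∀ A ∈ K, ∀ B ∈ K, A * B ∈ K)
    (hinv : ∀ A ∈ K, ∃ B ∈ K, A * B = 1 ∧ B * A = 1)
    (hL : ∀ A ∈ K, ∀ x ∈ connectedComponentIn M x₀, A *ᵥ x ∈ connectedComponentIn M x₀)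
    (htr : ∀ y ∈ connectedComponentIn M x₀, ∃ A ∈ K, A *ᵥ x₀ = y) : False := by
  classical
  have hx₀ : x₀ ∈ connectedComponentIn M x₀ := mem_connectedComponentIn hx₀M
  have hbig := dim_big h hm hm4 hlm
  have hpar : (-1 : ℝ) ^ (m * (m - 1) / 2) = 1 := by
    obtain ⟨k, rfl⟩ : ∃ k, m = 4 * k := ⟨m / 4, by omega⟩
    rw [show 4 * k * (4 * k - 1) / 2 = 2 * (k * (4 * k - 1)) by
      rw [show 4 * k * (4 * k - 1) = 2 * (2 * (k * (4 * k - 1))) by ring]; omega]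
    rw [pow_mul]; norm_num
  obtain ⟨Q, hQdef⟩ : ∃ Q, Q = qprod P m := ⟨_, rfl⟩
  have hQ2 : Q * Q = 1 := by rw [hQdef, qprod_sq h le_rfl, hpar, hη]; simp
  have hQs : Qᵀ = J * Q * J := by rw [hQdef, qprod_sym h le_rfl, hpar, one_smul]
  have hQP : ∀ j < m, P j * Q = - (Q * P j) := by
    intro j hj
    rw [hQdef, qprod_comm_lt h hj le_rfl, Odd.neg_one_pow (by rw [Nat.odd_iff]; omega)]
    simp
  have hLρ : ∀ A ∈ K, ∀ x ∈ connectedComponentIn M x₀, pq J m η P (A *ᵥ x) = ρ := fun A hA x hx =>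
    ((hM _).1 (connectedComponentIn_subset M x₀ (hL A hA x hx))).2
  have hne : ρ - ρ ^ 2 ≠ 0 := by
    have : ρ * (1 - ρ) ≠ 0 := mul_ne_zero hρ (by linarith)
    intro h0; apply this; linarith
  -- equal signs give equal squares
  have hsame : ∀ A ∈ K, ∀ B ∈ K, gam J m η P A x₀ = gam J m η P B x₀ →
      bf J (Q *ᵥ (B *ᵥ x₀)) (B *ᵥ x₀) ^ 2 = bf J (Q *ᵥ (A *ᵥ x₀)) (A *ᵥ x₀) ^ 2 := by
    intro A hA B hB hg
    obtain ⟨A', hA', hAA, hA'A⟩ := hinv A hA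
    obtain ⟨B', hB', hBB, _⟩ := hinv B hB
    have hs := same_sign h hρ hρ1 hM hx₀ hAA hBB (hO A hA) (hO B hB) (hLρ A hA) (hLρ B hB) hg
    obtain ⟨C', _, hCC, _⟩ := hinv _ (hmul B hB A' hA')
    have := h_invariant h hbig (by omega) (by rw [← hQdef]; exact hQ2) hCC
      (hO _ (hmul B hB A' hA')) (fun x => by
        rw [← mulVec_mulVec, ← hs, mulVec_mulVec, hAA, one_mulVec]) (A *ᵥ x₀)
    rw [← hQdef, mulVec_mulVec x₀, Matrix.mul_assoc, hA'A, Matrix.mul_one] at this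
    exact this
  let F : ℝ → ℝ := fun g => if hex : ∃ A ∈ K, gam J m η P A x₀ = g then
    bf J (Q *ᵥ (hex.choose *ᵥ x₀)) (hex.choose *ᵥ x₀) ^ 2 else 0
  have hcont : Continuous fun x => bf J (Q *ᵥ x) x ^ 2 :=
    (bf_continuous (mv_continuous _ continuous_id) continuous_id).pow 2
  have hk : ∀ x ∈ connectedComponentIn M x₀,
      bf J (Q *ᵥ x) x ^ 2 = bf J (Q *ᵥ x₀) x₀ ^ 2 := by
    intro x hx
    refine two_valued isPreconnected_connectedComponentIn hcont
      (S := F '' {ρ, 2 * ρ ^ 2 - ρ}) (Set.Finite.image _ (by simp)) ?_ hx hx₀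
    intro z hz
    obtain ⟨A, hA, rfl⟩ := htr z hz
    obtain ⟨A', hA', hAA, hA'A⟩ := hinv A hA
    obtain ⟨e, -⟩ := normal_form h hρ hρ1 hM hAA (hO A hA) (hLρ A hA) hx₀ rfl
    refine ⟨gam J m η P A x₀, ?_, ?_⟩
    · rcases mul_self_eq_one_iff.1 ((pow_two _).symm.trans e) with e | e <;>
        rw [div_eq_iff hne] at e
      · left; linarith
      · right; simp only [Set.mem_singleton_iff]; linarith
    · have hex : ∃ B ∈ K, gam J m η P B x₀ = gam J m η P A x₀ := ⟨A, hA, rfl⟩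
      simp only [F]
      rw [dif_pos hex]
      exact hsame A hA _ hex.choose_spec.1 hex.choose_spec.2.symm
  obtain ⟨k, hkdef⟩ : ∃ k, k = bf J (Q *ᵥ x₀) x₀ ^ 2 := ⟨_, rfl⟩
  rw [← hkdef] at hk
  have anq : ∀ x, AnalyticAt ℝ (fun y => bf J y y) x := fun x => by
    have := bf_analytic (J := J) 1 1 x
    simpa only [one_mulVec] using this
  have anh : ∀ x, AnalyticAt ℝ (fun y => bf J (Q *ᵥ y) y) x := fun x => by
    have := bf_analytic (J := J) Q 1 x
    simpa only [one_mulVec] using this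
  have anp : ∀ x, AnalyticAt ℝ (fun y => pq J m η P y) x := fun x => by
    have := pq_analytic (J := J) (m := m) (η := η) (P := P) 1 x
    simpa only [one_mulVec] using this
  have hid : ∀ y, (1 - ρ) * bf J (Q *ᵥ y) y ^ 2 = k * (bf J y y ^ 2 - pq J m η P y) := by
    refine analytic_ident (x := x₀)
      (fun x => analyticAt_const.fun_mul ((anh x).fun_pow 2))
      (fun x => analyticAt_const.fun_mul (((anq x).fun_pow 2).fun_sub (anp x))) ?_
    filter_upwards [ret_nbhd h hρ hρ1 hM hx₀] with y hy
    obtain ⟨t, -, htL⟩ := hy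
    have hz : t • rZ J m η P ρ y = (t * rT J m η P ρ y) • y +
        (t * rE J m η P ρ y) • (nm J m η P y *ᵥ y) := by
      unfold rZ; module
    generalize t • rZ J m η P ρ y = z at *
    obtain ⟨hq, hp⟩ := (hM z).1 (connectedComponentIn_subset M x₀ htL)
    obtain ⟨e1, -⟩ := plane_inv h hρ hρ1 hz hq hp
    have e2 := hk z htL
    rw [hz, hq_plane h hQP] at e2
    have hd : ((t * rT J m η P ρ y) ^ 2 - (t * rE J m η P ρ y) ^ 2 * pq J m η P y) ^ 2 ≠ 0 := by
      intro h0; rw [h0] at e1; linarith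
    apply mul_right_cancel₀ hd
    linear_combination (1 - ρ) * e2 - k * e1
  -- a non-null eigenvector
  obtain ⟨u, hQu, hqu⟩ : ∃ u, Q *ᵥ u = u ∧ bf J u u ≠ 0 := by
    have hq0 := ((hM x₀).1 hx₀M).1
    have QQ : ∀ w, Q *ᵥ (Q *ᵥ w) = w := fun w => by rw [mulVec_mulVec, hQ2, one_mulVec]
    by_cases h1 : bf J (x₀ + Q *ᵥ x₀) (x₀ + Q *ᵥ x₀) = 0
    · have hv : bf J (x₀ - Q *ᵥ x₀) (x₀ - Q *ᵥ x₀) ≠ 0 := by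
        intro h2
        have e := bf_adj h.JJ hQs x₀ (Q *ᵥ x₀)
        rw [QQ] at e
        simp only [bf_add_left, bf_add_right, bf_sub_left, bf_sub_right, hq0, e] at h1 h2
        linarith
      refine ⟨P 0 *ᵥ (x₀ - Q *ᵥ x₀), ?_, ?_⟩
      · have := hQP 0 (by omega)
        rw [mulVec_mulVec, show Q * P 0 = -(P 0 * Q) by rw [this, neg_neg], neg_mulVec,
          ← mulVec_mulVec, mulVec_sub, QQ, ← mulVec_neg, neg_sub]
      · rw [← bf_adj h.JJ (h.sym 0 (by omega)), mulVec_mulVec, h.sq 0 (by omega), smul_mulVec,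
          one_mulVec, bf_smul_left]
        refine mul_ne_zero ?_ hv
        intro h0; have := h.ηsq 0; rw [h0] at this; norm_num at this
    · exact ⟨_, by rw [mulVec_add, QQ, add_comm], h1⟩
  have hpu : ∀ v (ε : ℝ), ε ^ 2 = 1 → Q *ᵥ v = ε • v → ∀ j < m, bf J (P j *ᵥ v) v = 0 :=
    fun v ε hε hv j hj => anti_zero h hQs hQP hε hv hv hj
  have hQu1 : Q *ᵥ u = (1 : ℝ) • u := by rw [one_smul, hQu]
  have hpu0 : pq J m η P u = 0 := by
    unfold pq
    refine Finset.sum_eq_zero fun j hj => ?_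
    rw [hpu u 1 (by norm_num) hQu1 j (Finset.mem_range.1 hj)]; ring
  have hk1 : 1 - ρ = k := by
    have := hid u
    rw [hQu, hpu0, sub_zero] at this
    exact mul_right_cancel₀ (pow_ne_zero 2 hqu) this
  have hid2 : ∀ y, bf J (Q *ᵥ y) y ^ 2 = bf J y y ^ 2 - pq J m η P y := by
    intro y
    have := hid y
    rw [← hk1] at this
    exact mul_left_cancel₀ (by intro h0; linarith) this
  have : m = l := by
    refine trace_contra h (by omega) hQs hQP hqu ?_
    intro w
    have QQ : Q *ᵥ (Q *ᵥ w) = w := by rw [mulVec_mulVec, hQ2, one_mulVec]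
    obtain ⟨v, hv⟩ : ∃ v, v = (1/2 : ℝ) • (w - Q *ᵥ w) := ⟨_, rfl⟩
    have hQv : Q *ᵥ v = (-1 : ℝ) • v := by
      rw [hv, mulVec_smul, mulVec_sub, QQ]; module
    have hQv' : Q *ᵥ ((1/2 : ℝ) • (w + Q *ᵥ w)) = (1 : ℝ) • ((1/2 : ℝ) • (w + Q *ᵥ w)) := by
      rw [mulVec_smul, mulVec_add, QQ]; module
    have hsplit : w = v + (1/2 : ℝ) • (w + Q *ᵥ w) := by rw [hv]; module
    have hPw : ∀ j < m, bf J (P j *ᵥ u) w = bf J (P j *ᵥ u) v := by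
      intro j hj
      conv_lhs => rw [hsplit]
      rw [bf_add_right, anti_zero h hQs hQP (by norm_num) hQu1 hQv' hj, add_zero]
    have huv : bf J u v = 0 := by
      have := bf_adj h.JJ hQs u v
      rw [hQu, hQv, bf_smul_right] at this; linarith
    have hvu : bf J v u = 0 := by rw [bf_comm h.Jt, huv]
    have hqv : bf J v v = (bf J w w - bf J (Q *ᵥ w) w) / 2 := by
      have e := bf_adj h.JJ hQs w (Q *ᵥ w)
      rw [QQ] at e
      rw [hv]
      simp only [bf_smul_left, bf_smul_right, bf_sub_left, bf_sub_right, e, bf_comm h.Jt w (Q *ᵥ w)]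
      ring
    have hI := hid2 (u + v)
    have hpx : pq J m η P (u + v) = 4 * ∑ j ∈ Finset.range m, η j * bf J (P j *ᵥ u) w ^ 2 := by
      unfold pq
      rw [Finset.mul_sum]
      refine Finset.sum_congr rfl fun j hj => ?_
      have hj' := Finset.mem_range.1 hj
      rw [mulVec_add, bf_add_left, bf_add_right, bf_add_right,
        hpu u 1 (by norm_num) hQu1 j hj', hpu v (-1) (by norm_num) hQv j hj',
        bf_adj h.JJ (h.sym j hj') v u, bf_comm h.Jt v, ← hPw j hj']
      ring
    rw [hpx, mulVec_add, hQu, hQv] at hI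
    simp only [bf_add_left, bf_add_right, bf_smul_left, huv, hvu] at hI
    rw [← hqv]
    linear_combination (1/4 : ℝ) * hI
  omega

end core


lemma psJ_sq (n s : ℕ) : psJ n s * psJ n s = 1 := by
  unfold psJ
  rw [diagonal_mul_diagonal, ← diagonal_one]
  congr 1; funext i; split_ifs <;> norm_num

lemma psJ_t (n s : ℕ) : (psJ n s)ᵀ = psJ n s := by
  unfold psJ
  rw [diagonal_transpose]

lemma cliff_of_system {l s m r : ℕ} {P : ℕ → Matrix (Fin (2 * l)) (Fin (2 * l)) ℝ}
    (hP : IsCliffordSystem l s m r P) :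
    CliffData (2 * l) (psJ (2 * l) s) m (fun j => if j + 1 ≤ r then (-1 : ℝ) else 1)
      (fun j => P (j + 1)) where
  Jt := psJ_t _ _
  JJ := psJ_sq _ _
  ηsq := fun i => by split_ifs <;> norm_num
  sym := fun i hi => hP.1 (i + 1) (Finset.mem_Icc.2 ⟨by omega, by omega⟩)
  sq := fun i hi => by
    have hmem : i + 1 ∈ Finset.Icc 1 m := Finset.mem_Icc.2 ⟨by omega, by omega⟩
    have := hP.2 (i + 1) hmem (i + 1) hmem
    rw [← two_smul ℝ, mul_smul] at this
    have h2 := smul_right_injective _ (two_ne_zero (α := ℝ)) this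
    rw [h2]
    simp [cliffEta]
  anti := fun i hi j hj hne => by
    have := hP.2 (i + 1) (Finset.mem_Icc.2 ⟨by omega, by omega⟩) (j + 1)
      (Finset.mem_Icc.2 ⟨by omega, by omega⟩)
    rw [cliffEta, if_neg (by omega), mul_zero, zero_smul] at this
    exact eq_neg_of_add_eq_zero_left this

lemma prod_eta {m r : ℕ} (hr : r ≤ m) (hr2 : r % 2 = 0) :
    ∏ j ∈ Finset.range m, (if j + 1 ≤ r then (-1 : ℝ) else 1) = 1 := by
  rw [Finset.prod_ite, Finset.prod_const_one, mul_one, Finset.prod_const]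
  have : (Finset.range m).filter (fun j => j + 1 ≤ r) = Finset.range r := by
    ext j; simp only [Finset.mem_filter, Finset.mem_range]; omega
  rw [this, Finset.card_range]
  exact Even.neg_one_pow (Nat.even_iff.2 hr2)

lemma sum_shift (m : ℕ) (g : ℕ → ℝ) :
    ∑ j ∈ Finset.Icc 1 m, g j = ∑ j ∈ Finset.range m, g (j + 1) := by
  rw [Finset.range_eq_Ico, Finset.sum_Ico_add' g 0 m 1]
  rfl

/-- for a Clifford system of signature `(m, r)` on `ℝ^{2l}_s` with
`m ≡ 0 (mod 4)`, `r ≡ 0 (mod 2)`, `s ≤ 2l - 1`, `l > m`, let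
`f(x) = 1 - 2 Σ_j η_{jj} ⟨P_j x, x⟩²` on `S^{2l-1}_s` and `M_c = f⁻¹(c)`. If
`c ∈ W_RN(f) ∩ (-1, ∞)`, i.e. `c ∈ (-1, 1)` when `r = 0`, `c ∈ (-1, ∞) \ {1}` when
`0 < r < m`, and `c ∈ (1, ∞)` when `r = m`, then each connected component of `M_c`
is inhomogeneous. -/
theorem isoparametric_component_inhomogeneous (l s m r : ℕ) (hl : 0 < l)
    (hs : s ≤ 2 * l - 1)
    (hm : 2 ≤ m) (hm4 : m % 4 = 0) (hr : r ≤ m) (hr2 : r % 2 = 0) (hlm : m < l)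
    (P : ℕ → Matrix (Fin (2 * l)) (Fin (2 * l)) ℝ)
    (hP : IsCliffordSystem l s m r P)
    (f : (Fin (2 * l) → ℝ) → ℝ)
    (hf : f = fun x => 1 - 2 * ∑ j ∈ Finset.Icc 1 m,
      (if j ≤ r then (-1 : ℝ) else 1) * (psInner (2 * l) s (P j *ᵥ x) x) ^ 2)
    (c : ℝ)
    (hc : (r = 0 ∧ -1 < c ∧ c < 1) ∨
      (0 < r ∧ r < m ∧ -1 < c ∧ c ≠ 1) ∨
      (r = m ∧ 1 < c))
    (Mc : Set (Fin (2 * l) → ℝ))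
    (hMc : Mc = {x | psInner (2 * l) s x x = 1 ∧ f x = c}) :
    ∀ x₀ ∈ Mc, ¬ IsHomogeneousIn (2 * l) s (connectedComponentIn Mc x₀) := by
  intro x₀ hx₀ hhom
  obtain ⟨K, hO, -, hmul, hinv, hL, htr⟩ := hhom
  have h := cliff_of_system hP
  have hc1 : -1 < c ∧ c ≠ 1 := by
    rcases hc with ⟨_, h1, h2⟩ | ⟨_, _, h1, h2⟩ | ⟨_, h1⟩
    · exact ⟨h1, h2.ne⟩
    · exact ⟨h1, h2⟩
    · exact ⟨by linarith, h1.ne'⟩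
  refine core_contra (ρ := (1 - c) / 2) (M := Mc) (x₀ := x₀) h hm hm4 hlm (prod_eta hr hr2)
    ?_ ?_ ?_ hx₀ K hO hmul hinv hL (fun y hy => htr x₀ (mem_connectedComponentIn hx₀) y hy)
  · intro h0
    apply hc1.2; linarith
  · linarith [hc1.1]
  · intro x
    rw [hMc, Set.mem_setOf_eq, hf]
    have e : pq (psJ (2 * l) s) m (fun j => if j + 1 ≤ r then (-1 : ℝ) else 1)
        (fun j => P (j + 1)) x = ∑ j ∈ Finset.Icc 1 m,
          (if j ≤ r then (-1 : ℝ) else 1) * (psInner (2 * l) s (P j *ᵥ x) x) ^ 2 := by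
      rw [sum_shift]; rfl
    rw [e]
    have e2 : bf (psJ (2 * l) s) x x = psInner (2 * l) s x x := rfl
    rw [e2]
    beta_reduce
    constructor
    · rintro ⟨h1, h2⟩; exact ⟨h1, by linarith⟩
    · rintro ⟨h1, h2⟩; exact ⟨h1, by linarith⟩
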